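/- Let d ≥ 1 and let G = ([n], E) be a minimally d-rigid graph with n ≥ d+1 vertices. In the parametrised Laurent polynomial ring ℂ[a,b][x^±] with parameters a_{ij} (ij ∈ E, i < j) and b_{l,k} (l,k ∈ [d]) and Laurent variables x_{i,k} (i ∈ [n], k ∈ [d]), let I_V be the ideal generated by f^V_{ij} := Σ_{k=1}^d (x_{i,k} − x_{j,k})² − a_{ij} for ij ∈ E, and g^V_{i,l} := Σ_{k=1}^d b_{l,k}(x_{i,k} − 1) for i ∈ [d] and l ∈ [d+1−i]. Then the generic root count ℓ_{I_V, ℂ(a,b)} equals 2^d · c_d(G). -/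

import Mathlib

open scoped BigOperators

set_option synthInstance.maxHeartbeats 1000000
set_option maxHeartbeats 1000000

noncomputable section

namespace PaperDefs

/-- Two complex realisations are congruent if they differ by a complex orthogonal
transformation followed by a translation. -/
def Congruent {n d : ℕ} (p q : Fin n → Fin d → ℂ) : Prop :=
  ∃ (A : Matrix (Fin d) (Fin d) ℂ) (x : Fin d → ℂ),
    A * A.transpose = 1 ∧ A.transpose * A = 1 ∧ ∀ i, p i = A.mulVec (q i) + x

/-- Two real realisations are congruent if they differ by an isometry of `ℝ^d`. -/
def RealCongruent {n d : ℕ} (p q : Fin n → Fin d → ℝ) : Prop :=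
  ∃ (A : Matrix (Fin d) (Fin d) ℝ) (x : Fin d → ℝ),
    A * A.transpose = 1 ∧ A.transpose * A = 1 ∧ ∀ i, p i = A.mulVec (q i) + x

/-- The complex rigidity map `f_{G,d}`, recording half the squared edge lengths. -/
def rigidityMap {n : ℕ} (G : SimpleGraph (Fin n)) (d : ℕ)
    (p : Fin n → Fin d → ℂ) : G.edgeSet → ℂ :=
  fun e => Sym2.lift ⟨fun i j => (2⁻¹ : ℂ) * ∑ k, (p i k - p j k) ^ 2,
    fun i j => by
      have h : ∀ k, (p i k - p j k) ^ 2 = (p j k - p i k) ^ 2 := fun k => by ring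
      simp only [h]⟩ (e : Sym2 (Fin n))

/-- A real framework `(G,p)` is rigid: every continuous edge-length-preserving motion
starting at `p` stays congruent to `p`. -/
def IsRigidFramework {n : ℕ} (G : SimpleGraph (Fin n)) (d : ℕ)
    (p : Fin n → Fin d → ℝ) : Prop :=
  ∀ q : ℝ → Fin n → Fin d → ℝ,
    ContinuousOn q (Set.Icc 0 1) → q 0 = p →
    (∀ t ∈ Set.Icc (0 : ℝ) 1, ∀ i j, G.Adj i j →
        ∑ k, (q t i k - q t j k) ^ 2 = ∑ k, (p i k - p j k) ^ 2) →
    ∀ t ∈ Set.Icc (0 : ℝ) 1, RealCongruent (q t) p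

/-- `G` is `d`-rigid: generic real realisations give rigid frameworks. -/
def IsRigidGraph {n : ℕ} (G : SimpleGraph (Fin n)) (d : ℕ) : Prop :=
  ∃ f : MvPolynomial (Fin n × Fin d) ℝ, f ≠ 0 ∧
    ∀ p : Fin n → Fin d → ℝ,
      MvPolynomial.eval (fun v => p v.1 v.2) f ≠ 0 → IsRigidFramework G d p

/-- `G` is minimally `d`-rigid. -/
def IsMinimallyRigidGraph {n : ℕ} (G : SimpleGraph (Fin n)) (d : ℕ) : Prop :=
  IsRigidGraph G d ∧ ∀ e ∈ G.edgeSet, ¬ IsRigidGraph (G.deleteEdges {e}) d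

/-- The set of congruence classes of a set of complex realisations. -/
def congClasses {n d : ℕ} (S : Set (Fin n → Fin d → ℂ)) :
    Set (Set (Fin n → Fin d → ℂ)) :=
  (fun q => {q' ∈ S | Congruent q q'}) '' S

/-- `c` is the `d`-realisation number of `G`: for generic complex `p` the fibre of the
rigidity map through `p` has exactly `c` congruence classes. -/
def IsRealisationNumber {n : ℕ} (G : SimpleGraph (Fin n)) (d : ℕ) (c : ℕ) : Prop :=
  0 < c ∧ ∃ f : MvPolynomial (Fin n × Fin d) ℂ, f ≠ 0 ∧
    ∀ p : Fin n → Fin d → ℂ,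
      MvPolynomial.eval (fun v => p v.1 v.2) f ≠ 0 →
        (congClasses {q | rigidityMap G d q = rigidityMap G d p}).ncard = c

/-- The Zariski closure of the image of the rigidity map `f_{G,d}`. -/
def rigidityImageClosure {n : ℕ} (G : SimpleGraph (Fin n)) (d : ℕ) :
    Set (G.edgeSet → ℂ) :=
  {lam | ∀ f : MvPolynomial G.edgeSet ℂ,
    (∀ p, MvPolynomial.eval (rigidityMap G d p) f = 0) → MvPolynomial.eval lam f = 0}

/-- The Laurent polynomial ring over `K` in variables indexed by `V`, realised as the
group algebra of the free abelian group on `V`. -/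
abbrev LaurentRing (K : Type*) [CommRing K] (V : Type*) : Type _ :=
  AddMonoidAlgebra K (V →₀ ℤ)

/-- The Laurent variable `x_v`. -/
def LX {K : Type*} [CommRing K] {V : Type*} (v : V) : LaurentRing K V :=
  AddMonoidAlgebra.single (Finsupp.single v 1) 1

/-- The inverse Laurent variable `x_v⁻¹`. -/
def LXinv {K : Type*} [CommRing K] {V : Type*} (v : V) : LaurentRing K V :=
  AddMonoidAlgebra.single (Finsupp.single v (-1)) 1

/-- The field of rational functions `ℂ(a)` in parameters indexed by `P`. -/
abbrev RatFuncField (P : Type*) : Type _ := FractionRing (MvPolynomial P ℂ)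

/-- The parameter `a_p` as an element of `ℂ(a)`. -/
def ratParam {P : Type*} (p : P) : RatFuncField P :=
  algebraMap (MvPolynomial P ℂ) (RatFuncField P) (MvPolynomial.X p)

/-- The signed Laurent variable `y_{st,k}` attached to a dart (directed edge) of `G`:
it is `y_{e,k}` if the dart is increasingly oriented and `-y_{e,k}` otherwise, where `e`
is the underlying undirected edge. -/
def ydir {n : ℕ} {G : SimpleGraph (Fin n)} (K : Type*) [CommRing K] {d : ℕ}
    (dd : G.Dart) (k : Fin d) : LaurentRing K (↥G.edgeSet × Fin d) :=
  if dd.toProd.1 < dd.toProd.2 then LX (⟨dd.edge, dd.edge_mem⟩, k)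
  else - LX (⟨dd.edge, dd.edge_mem⟩, k)

/-- The signed Laurent variable `y_{st}` attached to a dart of `G` (single-variable
version). -/
def ydirE {n : ℕ} {G : SimpleGraph (Fin n)} (K : Type*) [CommRing K]
    (dd : G.Dart) : LaurentRing K ↥G.edgeSet :=
  if dd.toProd.1 < dd.toProd.2 then LX ⟨dd.edge, dd.edge_mem⟩
  else - LX ⟨dd.edge, dd.edge_mem⟩

/-- The signed inverse Laurent variable `y_{st}⁻¹` attached to a dart of `G`. -/
def ydirEinv {n : ℕ} {G : SimpleGraph (Fin n)} (K : Type*) [CommRing K]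
    (dd : G.Dart) : LaurentRing K ↥G.edgeSet :=
  if dd.toProd.1 < dd.toProd.2 then LXinv ⟨dd.edge, dd.edge_mem⟩
  else - LXinv ⟨dd.edge, dd.edge_mem⟩

section FieldTheory

open Algebra AlgebraicIndependent
open scoped IntermediateField.algebraAdjoinAdjoin

/-- The relative algebraic closure of `k(s)` inside `Ω`. -/
def relClosure (k : Type) {Ω : Type} [Field k] [Field Ω] [Algebra k Ω] (s : Set Ω) :
    IntermediateField k Ω :=
  (algebraicClosure (IntermediateField.adjoin k s) Ω).restrictScalars k

variable {k Ω : Type} [Field k] [Field Ω] [Algebra k Ω]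

theorem mem_relClosure_iff {s : Set Ω} {x : Ω} :
    x ∈ relClosure k s ↔ IsAlgebraic (Algebra.adjoin k s) x := by
  rw [relClosure, IntermediateField.mem_restrictScalars, mem_algebraicClosure_iff]
  exact (IsFractionRing.isAlgebraic_iff (Algebra.adjoin k s) (IntermediateField.adjoin k s) Ω).symm

theorem coe_relClosure (s : Set Ω) :
    (relClosure k s : Set Ω) = (matroid k Ω).closure s := by
  rw [matroid_closure_eq]
  ext x
  exact mem_relClosure_iff

theorem subset_relClosure (s : Set Ω) : s ⊆ relClosure k s := by
  rw [coe_relClosure]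
  exact (matroid k Ω).subset_closure s (by simp)

theorem mem_relClosure_range {ι : Type} (u : ι → Ω) (i : ι) :
    u i ∈ relClosure k (Set.range u) :=
  subset_relClosure _ ⟨i, rfl⟩

theorem relClosure_le {s t : Set Ω} (h : s ⊆ relClosure k t) :
    relClosure k s ≤ relClosure k t := by
  intro x hx
  have h1 : x ∈ (relClosure k s : Set Ω) := hx
  rw [coe_relClosure] at h h1
  have := (matroid k Ω).closure_subset_closure h h1
  rw [Matroid.closure_closure, ← coe_relClosure] at this
  exact this

theorem mem_relClosure_of_sq {s : Set Ω} {x : Ω} (h : x ^ 2 ∈ relClosure k s) :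
    x ∈ relClosure k s := by
  rw [mem_relClosure_iff] at *
  exact IsAlgebraic.of_pow two_pos h

theorem card_le_of_mem_relClosure {ι : Type} [Finite ι] {v : ι → Ω}
    (hv : AlgebraicIndependent k v) {s : Set Ω}
    (h : ∀ j, v j ∈ relClosure k s) : (Nat.card ι : ℕ∞) ≤ s.encard := by
  have hI : (matroid k Ω).Indep (Set.range v) := matroid_indep_iff.mpr hv.to_subtype_range
  have hsub : Set.range v ⊆ (matroid k Ω).closure s := by
    rw [← coe_relClosure]
    rintro _ ⟨j, rfl⟩
    exact h j
  have h1 : (Set.range v).encard ≤ s.encard :=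
    calc (Set.range v).encard = (matroid k Ω).eRk (Set.range v) := hI.eRk_eq_encard.symm
      _ ≤ (matroid k Ω).eRk ((matroid k Ω).closure s) := (matroid k Ω).eRk_mono hsub
      _ = (matroid k Ω).eRk s := (matroid k Ω).eRk_closure_eq s
      _ ≤ s.encard := (matroid k Ω).eRk_le_encard s
  rwa [← Set.image_univ, hv.injective.encard_image, Set.encard_univ, ENat.card_eq_coe_natCard] at h1

theorem algebraicIndependent_of_mem_relClosure {ι κ : Type} [Finite ι] [Finite κ]
    {u : ι → Ω} {v : κ → Ω} (hv : AlgebraicIndependent k v)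
    (h : ∀ j, v j ∈ relClosure k (Set.range u)) (hcard : Nat.card ι ≤ Nat.card κ) :
    AlgebraicIndependent k u := by
  have h1 := card_le_of_mem_relClosure hv h
  have h2 : (Set.range u).encard ≤ Nat.card ι := by
    rw [← Set.image_univ, ← ENat.card_eq_coe_natCard, ← Set.encard_univ]
    exact Set.encard_image_le _ _
  have h3 : (Set.range u).encard = Nat.card ι :=
    le_antisymm h2 (le_trans (by exact_mod_cast hcard) h1)
  have hinj : Function.Injective u := by
    rw [← Set.injOn_univ]
    have hf : (Set.univ : Set ι).Finite := Set.finite_univ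
    refine hf.injOn_of_encard_image_eq ?_
    rw [Set.image_univ, h3, Set.encard_univ, ENat.card_eq_coe_natCard]
  have hI : (matroid k Ω).Indep (Set.range v) := matroid_indep_iff.mpr hv.to_subtype_range
  have hsub : Set.range v ⊆ (matroid k Ω).closure (Set.range u) := by
    rw [← coe_relClosure]
    rintro _ ⟨j, rfl⟩
    exact h j
  have h4 : (Nat.card κ : ℕ∞) ≤ (matroid k Ω).eRk (Set.range u) :=
    calc (Nat.card κ : ℕ∞) = (Set.range v).encard := by
          rw [← Set.image_univ, hv.injective.encard_image, Set.encard_univ,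
            ENat.card_eq_coe_natCard]
      _ = (matroid k Ω).eRk (Set.range v) := hI.eRk_eq_encard.symm
      _ ≤ (matroid k Ω).eRk ((matroid k Ω).closure (Set.range u)) := (matroid k Ω).eRk_mono hsub
      _ = (matroid k Ω).eRk (Set.range u) := (matroid k Ω).eRk_closure_eq _
  have h5 : (matroid k Ω).Indep (Set.range u) := by
    rw [Matroid.indep_iff_eRk_eq_encard_of_finite (Set.finite_range u)]
    refine le_antisymm ((matroid k Ω).eRk_le_encard _) ?_
    rw [h3]
    exact le_trans (by exact_mod_cast hcard) h4
  rw [matroid_indep_iff] at h5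
  exact (algebraicIndependent_subtype_range hinj).1 h5

theorem aeval_ne_zero_of_algebraicIndependent {ι : Type} {p : ι → Ω}
    (hp : AlgebraicIndependent k p) (g : MvPolynomial ι k) (p' : ι → Ω)
    (h : MvPolynomial.aeval p' g ≠ 0) : MvPolynomial.aeval p g ≠ 0 := by
  intro h0
  apply h
  rw [algebraicIndependent_iff.mp hp g h0, map_zero]

theorem algebraicIndependent_of_specialization {ι κ : Type} {p : ι → Ω}
    (hp : AlgebraicIndependent k p) (g : κ → MvPolynomial ι k) (p' : ι → Ω)
    (h : AlgebraicIndependent k fun j => MvPolynomial.aeval p' (g j)) :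
    AlgebraicIndependent k fun j => MvPolynomial.aeval p (g j) := by
  rw [algebraicIndependent_iff] at h ⊢
  intro F hF
  by_contra hF0
  refine aeval_ne_zero_of_algebraicIndependent hp (MvPolynomial.bind₁ g F) p' ?_ ?_
  · rw [MvPolynomial.aeval_bind₁]
    exact fun h0 => hF0 (h F h0)
  · rwa [MvPolynomial.aeval_bind₁]

/-- Algebraically independent finite families in two uncountable algebraically closed fields of
characteristic zero and the same cardinality correspond under an isomorphism. -/
theorem exists_ringEquiv_of_algebraicIndependent {ι K L : Type} [Finite ι] [Field K] [Field L]
    [CharZero K] [CharZero L] [IsAlgClosed K] [IsAlgClosed L] [Algebra ℚ K] [Algebra ℚ L]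
    (hK : Cardinal.aleph0 < Cardinal.mk K) (hKL : Cardinal.mk K = Cardinal.mk L)
    {u : ι → K} {v : ι → L}
    (hu : AlgebraicIndependent ℚ u) (hv : AlgebraicIndependent ℚ v) :
    ∃ σ : K ≃+* L, ∀ i, σ (u i) = v i := by
  let : Algebra (MvPolynomial ι ℚ) K := (MvPolynomial.aeval u).toRingHom.toAlgebra
  let : Algebra (MvPolynomial ι ℚ) L := (MvPolynomial.aeval v).toRingHom.toAlgebra
  have hcu : ∀ r, algebraMap (MvPolynomial ι ℚ) K r = MvPolynomial.aeval u r := fun _ => rfl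
  have hcv : ∀ r, algebraMap (MvPolynomial ι ℚ) L r = MvPolynomial.aeval v r := fun _ => rfl
  have : FaithfulSMul (MvPolynomial ι ℚ) K := (faithfulSMul_iff_algebraMap_injective _ _).mpr hu
  have : FaithfulSMul (MvPolynomial ι ℚ) L := (faithfulSMul_iff_algebraMap_injective _ _).mpr hv
  have hR : Cardinal.mk (MvPolynomial ι ℚ) ≤ Cardinal.aleph0 := by
    refine le_trans (MvPolynomial.cardinalMk_le_max) ?_
    simp
  obtain ⟨s, hs⟩ := exists_isTranscendenceBasis (MvPolynomial ι ℚ) K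
  obtain ⟨t, ht⟩ := exists_isTranscendenceBasis (MvPolynomial ι ℚ) L
  have h1 := IsAlgClosed.cardinal_eq_cardinal_transcendence_basis_of_aleph0_lt' _ hs hR hK
  have h2 := IsAlgClosed.cardinal_eq_cardinal_transcendence_basis_of_aleph0_lt' _ ht hR (hKL ▸ hK)
  obtain ⟨e⟩ : Nonempty (s ≃ t) := Cardinal.eq.1 (h1.symm.trans (hKL.trans h2))
  let := IsAlgClosed.isAlgClosure_of_transcendence_basis _ hs
  let := IsAlgClosed.isAlgClosure_of_transcendence_basis _ ht
  let E : Algebra.adjoin (MvPolynomial ι ℚ) (Set.range ((↑) : s → K)) ≃ₐ[MvPolynomial ι ℚ]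
      Algebra.adjoin (MvPolynomial ι ℚ) (Set.range ((↑) : t → L)) :=
    (hs.1.aevalEquiv.symm.trans (MvPolynomial.renameEquiv _ e)).trans ht.1.aevalEquiv
  refine ⟨IsAlgClosure.equivOfEquiv K L E.toRingEquiv, fun i => ?_⟩
  have h3 := IsAlgClosure.equivOfEquiv_algebraMap K L E.toRingEquiv
    (algebraMap (MvPolynomial ι ℚ) _ (MvPolynomial.X i))
  rw [← IsScalarTower.algebraMap_apply, hcu] at h3
  rw [MvPolynomial.aeval_X] at h3
  rw [h3]
  have h4 : E.toRingEquiv (algebraMap (MvPolynomial ι ℚ) _ (MvPolynomial.X i)) =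
    algebraMap (MvPolynomial ι ℚ) _ (MvPolynomial.X i) := E.commutes _
  rw [h4, ← IsScalarTower.algebraMap_apply, hcv, MvPolynomial.aeval_X]

end FieldTheory

section EdgeLengths

/-- The squared length of the pair `e` in the realisation `p` over a commutative ring. -/
def sqLen {n d : ℕ} {R : Type*} [CommRing R] (p : Fin n → Fin d → R) (e : Sym2 (Fin n)) : R :=
  Sym2.lift ⟨fun i j => ∑ k, (p i k - p j k) ^ 2,
    fun i j => Finset.sum_congr rfl fun k _ => by ring⟩ e

variable {n d : ℕ}

@[simp]
theorem sqLen_mk {R : Type*} [CommRing R] (p : Fin n → Fin d → R) (i j : Fin n) :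
    sqLen p s(i, j) = ∑ k, (p i k - p j k) ^ 2 := rfl

theorem map_sqLen {R S F : Type*} [CommRing R] [CommRing S] [FunLike F R S] [RingHomClass F R S]
    (φ : F) (p : Fin n → Fin d → R) (e : Sym2 (Fin n)) :
    φ (sqLen p e) = sqLen (fun i k => φ (p i k)) e := by
  induction e with
  | h i j => simp [map_sum, map_pow, map_sub]

theorem rigidityMap_eq_iff {G : SimpleGraph (Fin n)} {p q : Fin n → Fin d → ℂ} :
    rigidityMap G d p = rigidityMap G d q ↔ ∀ e : G.edgeSet, sqLen p (e : Sym2 (Fin n)) = sqLen q e := by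
  rw [funext_iff]
  refine forall_congr' fun ⟨e, he⟩ => ?_
  induction e with
  | h i j =>
    show (2⁻¹ : ℂ) * _ = 2⁻¹ * _ ↔ _
    rw [mul_right_inj' (by norm_num)]
    rfl

/-- The generic realisation, whose coordinates are polynomial variables. -/
def genericReal (n d : ℕ) (R : Type*) [CommRing R] : Fin n → Fin d → MvPolynomial (Fin n × Fin d) R :=
  fun i k => MvPolynomial.X (i, k)

theorem aeval_sqLen_genericReal {R S : Type*} [CommRing R] [CommRing S] [Algebra R S]
    (p : Fin n → Fin d → S) (e : Sym2 (Fin n)) :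
    MvPolynomial.aeval (fun v : Fin n × Fin d => p v.1 v.2) (sqLen (genericReal n d R) e) =
      sqLen p e := by
  rw [map_sqLen]
  simp [genericReal]

theorem algebraicIndependent_sqLen_genericReal {G : SimpleGraph (Fin n)}
    (hG : IsMinimallyRigidGraph G d) :
    AlgebraicIndependent ℝ fun e : G.edgeSet => sqLen (genericReal n d ℝ) (e : Sym2 (Fin n)) := by
  obtain ⟨⟨f, hf, hrig⟩, hmin⟩ := hG
  set x : G.edgeSet → MvPolynomial (Fin n × Fin d) ℝ :=
    fun e : G.edgeSet => sqLen (genericReal n d ℝ) (e : Sym2 (Fin n)) with hx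
  refine algebraicIndependent_of_finite_type'
    (FaithfulSMul.algebraMap_injective _ _) fun t _ _ e het halg => ?_
  obtain ⟨P, hP0, hPe⟩ := halg
  refine hmin e e.2 ⟨f * (P.leadingCoeff : MvPolynomial (Fin n × Fin d) ℝ), mul_ne_zero hf ?_, ?_⟩
  · simpa using hP0
  intro p hp q hqc hq0 hqlen
  rw [map_mul, mul_ne_zero_iff] at hp
  let φ : (Fin n → Fin d → ℝ) → Algebra.adjoin ℝ (x '' t) →ₐ[ℝ] ℝ := fun p =>
    (MvPolynomial.aeval fun v : Fin n × Fin d => p v.1 v.2).comp (Algebra.adjoin ℝ (x '' t)).val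
  have hφ : ∀ s ∈ Set.Icc (0 : ℝ) 1, φ (q s) = φ p := by
    intro s hs
    refine AlgHom.adjoin_ext ?_
    rintro _ ⟨e', he', rfl⟩
    simp only [φ, AlgHom.comp_apply, Subalgebra.coe_val, hx]
    rw [aeval_sqLen_genericReal, aeval_sqLen_genericReal]
    have hne : (e' : Sym2 (Fin n)) ≠ e := fun h => het (Subtype.ext h ▸ he')
    obtain ⟨e', he'G⟩ := e'
    induction e' with
    | h i j =>
      refine hqlen s hs i j ?_
      rw [SimpleGraph.deleteEdges_adj]
      exact ⟨he'G, hne⟩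
  have hroot : ∀ r : Fin n → Fin d → ℝ,
      (P.map (φ r : Algebra.adjoin ℝ (x '' t) →+* ℝ)).IsRoot (sqLen r e) := by
    intro r
    have := congrArg (MvPolynomial.aeval (R := ℝ) fun v : Fin n × Fin d => r v.1 v.2) hPe
    rw [map_zero, Polynomial.aeval_def, ← AlgHom.coe_toRingHom, Polynomial.hom_eval₂] at this
    rw [Polynomial.IsRoot, Polynomial.eval_map, ← aeval_sqLen_genericReal (R := ℝ) r]
    exact this
  have hPp : P.map (φ p : Algebra.adjoin ℝ (x '' t) →+* ℝ) ≠ 0 := by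
    intro h0
    have := congrArg (fun Q => Q.coeff P.natDegree) h0
    simp only [Polynomial.coeff_map, Polynomial.coeff_zero] at this
    exact hp.2 (by simpa [φ, MvPolynomial.coe_aeval_eq_eval] using this)
  have hcont : ContinuousOn (fun s => sqLen (q s) (e : Sym2 (Fin n))) (Set.Icc 0 1) := by
    obtain ⟨e, he⟩ := e
    induction e with
    | h i j =>
      simp only [sqLen_mk]
      have hc : ∀ i k, ContinuousOn (fun s => q s i k) (Set.Icc 0 1) := fun i k =>
        (continuous_apply k).comp_continuousOn ((continuous_apply i).comp_continuousOn hqc)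
      exact continuousOn_finsetSum _ fun k _ => ((hc i k).sub (hc j k)).pow 2
  have hsub : ((fun s => sqLen (q s) (e : Sym2 (Fin n))) '' Set.Icc 0 1).Subsingleton := by
    by_contra hnt
    rw [Set.not_subsingleton_iff] at hnt
    refine (isPreconnected_Icc.image _ hcont).infinite_of_nontrivial hnt ?_
    refine (Polynomial.rootSet_finite (P.map (φ p : Algebra.adjoin ℝ (x '' t) →+* ℝ)) ℝ).subset ?_
    rintro _ ⟨s, hs, rfl⟩
    rw [Polynomial.mem_rootSet]
    refine ⟨hPp, ?_⟩
    rw [Polynomial.coe_aeval_eq_eval, ← hφ s hs]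
    exact hroot (q s)
  refine hrig p hp.1 q hqc hq0 fun s hs i j hij => ?_
  by_cases hije : s(i, j) = e
  · have := hsub ⟨s, hs, rfl⟩ ⟨0, by simp, rfl⟩
    simp only [hq0, ← hije, sqLen_mk] at this
    exact this
  · exact hqlen s hs i j (by rw [SimpleGraph.deleteEdges_adj]; exact ⟨hij, hije⟩)

theorem algebraicIndependent_sqLen {Ω : Type} [Field Ω] [Algebra ℚ Ω] {G : SimpleGraph (Fin n)}
    (hG : IsMinimallyRigidGraph G d) {p : Fin n → Fin d → Ω}
    (hp : AlgebraicIndependent ℚ fun v : Fin n × Fin d => p v.1 v.2) :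
    AlgebraicIndependent ℚ fun e : G.edgeSet => sqLen p (e : Sym2 (Fin n)) := by
  have h := algebraicIndependent_sqLen_genericReal hG
  rw [algebraicIndependent_iff] at h ⊢
  intro F hF
  have h1 : MvPolynomial.aeval (fun v : Fin n × Fin d => p v.1 v.2)
      (MvPolynomial.bind₁ (fun e : G.edgeSet => sqLen (genericReal n d ℚ) (e : Sym2 (Fin n))) F) = 0 := by
    rw [MvPolynomial.aeval_bind₁]
    simpa only [aeval_sqLen_genericReal] using hF
  have h2 := algebraicIndependent_iff.mp hp _ h1
  have h3 := h (MvPolynomial.map (algebraMap ℚ ℝ) F) (by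
    have := congrArg (MvPolynomial.map (algebraMap ℚ ℝ)) h2
    rw [map_zero, MvPolynomial.map_bind₁] at this
    rw [← this, MvPolynomial.bind₁]
    congr 2
    ext1 e
    rw [map_sqLen]
    simp only [genericReal, MvPolynomial.map_X]
    rfl)
  exact (MvPolynomial.map_injective _ (algebraMap ℚ ℝ).injective) (by rw [h3, map_zero])

end EdgeLengths

section Gram

open Matrix

theorem det_mem_of_forall_mem {ι R : Type*} [Fintype ι] [DecidableEq ι] [CommRing R]
    {T : Subring R} {B : Matrix ι ι R} (hB : ∀ i j, B i j ∈ T) : B.det ∈ T := by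
  let B' : Matrix ι ι T := Matrix.of fun i j => ⟨B i j, hB i j⟩
  have h := T.subtype.map_det B'
  have h2 : T.subtype.mapMatrix B' = B := by ext i j; rfl
  rw [h2] at h
  rw [← h]
  exact B'.det.2

theorem adjugate_mem_of_forall_mem {ι R : Type*} [Fintype ι] [DecidableEq ι] [CommRing R]
    {T : Subring R} {B : Matrix ι ι R} (hB : ∀ i j, B i j ∈ T) (i j : ι) :
    B.adjugate i j ∈ T := by
  let B' : Matrix ι ι T := Matrix.of fun i j => ⟨B i j, hB i j⟩
  have h := T.subtype.map_adjugate B'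
  have h2 : T.subtype.mapMatrix B' = B := by ext i j; rfl
  rw [h2] at h
  rw [← h]
  exact (B'.adjugate i j).2

theorem inv_mem_of_forall_mem {ι Ω k : Type} [Fintype ι] [DecidableEq ι] [Field k] [Field Ω]
    [Algebra k Ω] {T : IntermediateField k Ω} {B : Matrix ι ι Ω} (hB : ∀ i j, B i j ∈ T) (i j : ι) :
    B⁻¹ i j ∈ T := by
  rw [Matrix.inv_def, Matrix.smul_apply, smul_eq_mul, Ring.inverse_eq_inv']
  exact mul_mem (inv_mem (det_mem_of_forall_mem (T := T.toSubfield.toSubring) hB))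
    (adjugate_mem_of_forall_mem (T := T.toSubfield.toSubring) hB i j)

/-- Positions of the lower trapezoidal part of an `N × d` matrix. -/
abbrev PinIdx (N d : ℕ) : Type := {v : Fin N × Fin d // v.2.val ≤ v.1.val}

variable {N d : ℕ} {Ω : Type} [Field Ω]

/-- The entries of the Gram matrix of the rows of `W` in the positions of `PinIdx`. -/
def pinGram (h : d ≤ N) (W : Matrix (Fin N) (Fin d) Ω) (v : PinIdx N d) : Ω :=
  (W * Wᵀ) v.1.1 (Fin.castLE h v.1.2)

/-- The square matrix formed by the first `d` rows. -/
def topRows (h : d ≤ N) (W : Matrix (Fin N) (Fin d) Ω) : Matrix (Fin d) (Fin d) Ω :=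
  W.submatrix (Fin.castLE h) id

/-- The lower trapezoidal matrix with prescribed entries. -/
def lowerTrap (y : PinIdx N d → Ω) : Matrix (Fin N) (Fin d) Ω :=
  Matrix.of fun i k => if hik : k.val ≤ i.val then y ⟨(i, k), hik⟩ else 0

theorem det_topRows_of_lower (h : d ≤ N) {Y : Matrix (Fin N) (Fin d) Ω}
    (hY : ∀ i k, i.val < k.val → Y i k = 0) :
    (topRows h Y).det = ∏ k, Y (Fin.castLE h k) k := by
  rw [Matrix.det_of_isLowerTriangular]
  · rfl
  · intro i j hij
    exact hY _ _ hij

theorem lowerTrap_lower (y : PinIdx N d → Ω) (i : Fin N) (k : Fin d) (hik : i.val < k.val) :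
    lowerTrap y i k = 0 := by
  simp [lowerTrap, not_le.mpr hik]

theorem exists_pinIdx (h : d ≤ N) (i : Fin N) (k : Fin d) : ∃ v : PinIdx N d,
    ∀ W : Matrix (Fin N) (Fin d) Ω, (W * (topRows h W)ᵀ) i k = pinGram h W v := by
  by_cases hik : k.val ≤ i.val
  · exact ⟨⟨(i, k), hik⟩, fun W => rfl⟩
  · push Not at hik
    refine ⟨⟨(Fin.castLE h k, ⟨i, hik.trans k.2⟩), hik.le⟩, fun W => ?_⟩
    simp only [pinGram, topRows, Matrix.mul_apply, Matrix.transpose_apply, Matrix.submatrix_apply,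
      id_eq]
    exact Finset.sum_congr rfl fun l _ => mul_comm _ _

theorem exists_orthogonal_of_pinGram_eq (h : d ≤ N) {W₁ W₂ : Matrix (Fin N) (Fin d) Ω}
    (h₁ : (topRows h W₁).det ≠ 0) (h₂ : (topRows h W₂).det ≠ 0)
    (hM : pinGram h W₁ = pinGram h W₂) :
    ∃ Q : Matrix (Fin d) (Fin d) Ω, Q * Qᵀ = 1 ∧ W₂ = W₁ * Q := by
  have e : W₁ * (topRows h W₁)ᵀ = W₂ * (topRows h W₂)ᵀ := by
    ext i k
    obtain ⟨v, hv⟩ := exists_pinIdx (Ω := Ω) h i k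
    rw [hv, hv, hM]
  set D₁ := topRows h W₁
  set D₂ := topRows h W₂
  have e' : D₁ * D₁ᵀ = D₂ * D₂ᵀ := by
    ext i k
    exact congrFun (congrFun e (Fin.castLE h i)) k
  have u₁ : IsUnit D₁.det := isUnit_iff_ne_zero.mpr h₁
  have u₂ : IsUnit D₂.det := isUnit_iff_ne_zero.mpr h₂
  have u₂' : IsUnit D₂ᵀ.det := by rwa [Matrix.det_transpose]
  have u₁' : IsUnit D₁ᵀ.det := by rwa [Matrix.det_transpose]
  have hQ : D₁⁻¹ * D₂ = D₁ᵀ * D₂ᵀ⁻¹ := by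
    calc D₁⁻¹ * D₂ = D₁⁻¹ * (D₂ * D₂ᵀ) * D₂ᵀ⁻¹ := by
          rw [Matrix.mul_assoc, Matrix.mul_assoc, Matrix.mul_nonsing_inv _ u₂', Matrix.mul_one]
      _ = D₁⁻¹ * D₁ * D₁ᵀ * D₂ᵀ⁻¹ := by rw [← e']; simp only [Matrix.mul_assoc]
      _ = _ := by rw [Matrix.nonsing_inv_mul _ u₁, Matrix.one_mul]
  refine ⟨D₁⁻¹ * D₂, ?_, ?_⟩
  · rw [Matrix.transpose_mul, Matrix.transpose_nonsing_inv]
    calc D₁⁻¹ * D₂ * (D₂ᵀ * D₁ᵀ⁻¹) = D₁⁻¹ * (D₂ * D₂ᵀ) * D₁ᵀ⁻¹ := by simp only [Matrix.mul_assoc]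
      _ = D₁⁻¹ * D₁ * (D₁ᵀ * D₁ᵀ⁻¹) := by rw [← e']; simp only [Matrix.mul_assoc]
      _ = 1 := by
        rw [Matrix.nonsing_inv_mul _ u₁, Matrix.mul_nonsing_inv _ u₁', Matrix.one_mul]
  · rw [hQ, ← Matrix.mul_assoc, e, Matrix.mul_assoc, Matrix.mul_nonsing_inv _ u₂', Matrix.mul_one]

variable [Algebra ℚ Ω]

theorem mem_relClosure_pinGram_of_lower (h : d ≤ N) {Y : Matrix (Fin N) (Fin d) Ω}
    (hY : ∀ i k, i.val < k.val → Y i k = 0) (hdiag : ∀ k, Y (Fin.castLE h k) k ≠ 0)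
    (k : Fin d) : ∀ i, Y i k ∈ relClosure ℚ (Set.range (pinGram h Y)) := by
  induction k using WellFoundedLT.induction with
  | ind k ih =>
  set T := relClosure ℚ (Set.range (pinGram h Y))
  have key : ∀ i : Fin N, k.val ≤ i.val → Y i k * Y (Fin.castLE h k) k ∈ T := by
    intro i hik
    have h1 : pinGram h Y ⟨(i, k), hik⟩ ∈ T := mem_relClosure_range _ _
    have h2 : pinGram h Y ⟨(i, k), hik⟩ = Y i k * Y (Fin.castLE h k) k +
        ∑ l ∈ Finset.univ.erase k, Y i l * Y (Fin.castLE h k) l := by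
      refine Eq.trans ?_ (Finset.add_sum_erase Finset.univ
        (fun l => Y i l * Y (Fin.castLE h k) l) (Finset.mem_univ k)).symm
      simp [pinGram, Matrix.mul_apply]
    have h3 : ∑ l ∈ Finset.univ.erase k, Y i l * Y (Fin.castLE h k) l ∈ T := by
      refine sum_mem fun l hl => ?_
      rcases lt_or_gt_of_ne (Finset.ne_of_mem_erase hl) with hlk | hlk
      · exact mul_mem (ih l hlk i) (ih l hlk _)
      · rw [hY (Fin.castLE h k) l hlk, mul_zero]
        exact zero_mem T
    rw [eq_sub_of_add_eq h2.symm]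
    exact sub_mem h1 h3
  have hkk : Y (Fin.castLE h k) k ∈ T := by
    refine mem_relClosure_of_sq ?_
    rw [sq]
    exact key _ (by simp)
  intro i
  by_cases hik : k.val ≤ i.val
  · have := div_mem (key i hik) hkk
    rwa [mul_div_cancel_right₀ _ (hdiag k)] at this
  · rw [hY i k (not_le.mp hik)]
    exact zero_mem T

theorem lowerTrap_diag_ne_zero (h : d ≤ N) {y : PinIdx N d → Ω} (hy : AlgebraicIndependent ℚ y)
    (k : Fin d) : lowerTrap y (Fin.castLE h k) k ≠ 0 := by
  simpa [lowerTrap] using hy.ne_zero _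

theorem algebraicIndependent_pinGram_lowerTrap (h : d ≤ N) {y : PinIdx N d → Ω}
    (hy : AlgebraicIndependent ℚ y) : AlgebraicIndependent ℚ (pinGram h (lowerTrap y)) := by
  refine algebraicIndependent_of_mem_relClosure hy (fun v => ?_) le_rfl
  have := mem_relClosure_pinGram_of_lower h (lowerTrap_lower y) (lowerTrap_diag_ne_zero h hy)
    v.1.2 v.1.1
  simpa [lowerTrap, v.2] using this

theorem det_topRows_lowerTrap_ne_zero (h : d ≤ N) {y : PinIdx N d → Ω}
    (hy : AlgebraicIndependent ℚ y) : (topRows h (lowerTrap y)).det ≠ 0 := by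
  rw [det_topRows_of_lower h (lowerTrap_lower y)]
  exact Finset.prod_ne_zero_iff.mpr fun k _ => lowerTrap_diag_ne_zero h hy k

theorem map_pinGram {F R S : Type} [Field R] [Field S] [FunLike F R S] [RingHomClass F R S]
    (φ : F) (h : d ≤ N) (W : Matrix (Fin N) (Fin d) R) (v : PinIdx N d) :
    φ (pinGram h W v) = pinGram h (W.map φ) v := by
  simp [pinGram, Matrix.mul_apply, map_sum]

/-- A matrix depending polynomially and surjectively on an algebraically independent point has
generic Gram entries and independent first rows. -/
theorem generic_of_surjective {V : Type} (h : d ≤ N) {p : V → Ω} (hp : AlgebraicIndependent ℚ p)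
    (g : Matrix (Fin N) (Fin d) (MvPolynomial V ℚ))
    (hg : ∀ Z : Matrix (Fin N) (Fin d) Ω, ∃ p' : V → Ω, g.map (MvPolynomial.aeval p') = Z)
    {y : PinIdx N d → Ω} (hy : AlgebraicIndependent ℚ y) :
    AlgebraicIndependent ℚ (pinGram h (g.map (MvPolynomial.aeval p))) ∧
      (topRows h (g.map (MvPolynomial.aeval p))).det ≠ 0 := by
  obtain ⟨p', hp'⟩ := hg (lowerTrap y)
  have e1 : ∀ q : V → Ω, ∀ v, pinGram h (g.map (MvPolynomial.aeval q)) v =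
      MvPolynomial.aeval q ((g * gᵀ) v.1.1 (Fin.castLE h v.1.2)) := by
    intro q v
    simp [pinGram, Matrix.mul_apply, map_sum]
  have e2 : ∀ q : V → Ω, (topRows h (g.map (MvPolynomial.aeval q))).det =
      MvPolynomial.aeval q (g.submatrix (Fin.castLE h) id).det := by
    intro q
    rw [AlgHom.map_det]
    rfl
  constructor
  · have := algebraicIndependent_of_specialization hp
      (fun v : PinIdx N d => (g * gᵀ) v.1.1 (Fin.castLE h v.1.2)) p' (by
        simp only [← e1]
        rw [hp']
        exact algebraicIndependent_pinGram_lowerTrap h hy)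
    simpa only [← e1] using this
  · rw [e2]
    refine aeval_ne_zero_of_algebraicIndependent hp _ p' ?_
    rw [← e2, hp']
    exact det_topRows_lowerTrap_ne_zero h hy

theorem gram_mem_relClosure_pinGram (h : d ≤ N) {W : Matrix (Fin N) (Fin d) Ω}
    (hW : (topRows h W).det ≠ 0) (i j : Fin N) :
    (W * Wᵀ) i j ∈ relClosure ℚ (Set.range (pinGram h W)) := by
  set T := relClosure ℚ (Set.range (pinGram h W))
  set D := topRows h W with hD
  have hu : IsUnit D.det := isUnit_iff_ne_zero.mpr hW
  have hu' : IsUnit Dᵀ.det := by rwa [Matrix.det_transpose]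
  have h1 : ∀ i k, (W * Dᵀ) i k ∈ T := fun i k => by
    obtain ⟨v, hv⟩ := exists_pinIdx (Ω := Ω) h i k
    rw [hD, hv W]
    exact mem_relClosure_range _ _
  have h2 : ∀ i j, (D * Dᵀ) i j ∈ T := fun i j => h1 (Fin.castLE h i) j
  have h3 : W * Wᵀ = W * Dᵀ * (D * Dᵀ)⁻¹ * (W * Dᵀ)ᵀ := by
    rw [Matrix.mul_inv_rev, Matrix.transpose_mul, Matrix.transpose_transpose]
    calc W * Wᵀ = W * (Dᵀ * Dᵀ⁻¹) * (D⁻¹ * D) * Wᵀ := by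
          rw [Matrix.mul_nonsing_inv _ hu', Matrix.nonsing_inv_mul _ hu]; simp
      _ = _ := by simp only [Matrix.mul_assoc]
  rw [h3, Matrix.mul_apply]
  refine sum_mem fun k _ => mul_mem ?_ (h1 j k)
  rw [Matrix.mul_apply]
  exact sum_mem fun l _ => mul_mem (h1 i l) (inv_mem_of_forall_mem h2 l k)

theorem exists_aut_orthogonal (h : d ≤ N) {W₁ W₂ : Matrix (Fin N) (Fin d) ℂ}
    (h₁ : (topRows h W₁).det ≠ 0) (h₂ : (topRows h W₂).det ≠ 0)
    (hM₁ : AlgebraicIndependent ℚ (pinGram h W₁)) (hM₂ : AlgebraicIndependent ℚ (pinGram h W₂)) :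
    ∃ (σ : ℂ ≃+* ℂ) (Q : Matrix (Fin d) (Fin d) ℂ), Q * Qᵀ = 1 ∧ W₂ = W₁.map σ * Q := by
  obtain ⟨σ, hσ⟩ := exists_ringEquiv_of_algebraicIndependent
    (by rw [Cardinal.mk_complex]; exact Cardinal.aleph0_lt_continuum) rfl hM₁ hM₂
  refine ⟨σ, exists_orthogonal_of_pinGram_eq h ?_ h₂ ?_⟩
  · have : topRows h (W₁.map σ) = σ.toRingHom.mapMatrix (topRows h W₁) := rfl
    rw [this, ← RingHom.map_det]
    simpa using h₁
  · ext v
    rw [← hσ, map_pinGram]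

end Gram

section Pinning

open Matrix

variable {N d : ℕ}

/-- Entries above the diagonal vanish. -/
def IsLower {R : Type} [Zero R] (X : Matrix (Fin N) (Fin d) R) : Prop :=
  ∀ i k, i.val < k.val → X i k = 0

theorem IsLower.mul {R : Type} [CommRing R] {X : Matrix (Fin N) (Fin d) R}
    {L : Matrix (Fin d) (Fin d) R} (hX : IsLower X) (hL : IsLower L) : IsLower (X * L) := by
  intro i k hik
  rw [Matrix.mul_apply]
  refine Finset.sum_eq_zero fun l _ => ?_
  rcases lt_or_ge i.val l.val with h | h
  · rw [hX i l h, zero_mul]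
  · rw [hL l k (by omega), mul_zero]

variable {Ω : Type} [Field Ω]

theorem IsLower.inv {L : Matrix (Fin d) (Fin d) Ω} (hL : IsLower L) (hu : IsUnit L.det) :
    IsLower L⁻¹ := by
  have hT : L.BlockTriangular OrderDual.toDual := fun i j hij => hL i j hij
  have := Matrix.invertibleOfIsUnitDet L hu
  exact fun i j hij => Matrix.blockTriangular_inv_of_blockTriangular hT hij

theorem isLower_mul_iff {X : Matrix (Fin N) (Fin d) Ω} {L : Matrix (Fin d) (Fin d) Ω}
    (hL : IsLower L) (hu : IsUnit L.det) : IsLower (X * L) ↔ IsLower X := by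
  refine ⟨fun h => ?_, fun h => h.mul hL⟩
  have := h.mul (hL.inv hu)
  rwa [Matrix.mul_assoc, Matrix.mul_nonsing_inv _ hu, Matrix.mul_one] at this

/-- An orthogonal matrix preserving lower trapezoidal shape is a diagonal sign matrix. -/
theorem exists_signs_of_isLower (h : d ≤ N) {Z : Matrix (Fin N) (Fin d) Ω} (hZ : IsLower Z)
    (hdiag : ∀ k, Z (Fin.castLE h k) k ≠ 0) {O : Matrix (Fin d) (Fin d) Ω} (hO : O * Oᵀ = 1)
    (hZO : IsLower (Z * O)) :
    ∃ ε : Fin d → ℤˣ, O = Matrix.diagonal fun k => (((ε k : ℤˣ) : ℤ) : Ω) := by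
  have hD : IsLower (topRows h Z) := fun i k hik => hZ _ _ hik
  have hDO : IsLower (topRows h Z * O) := fun i k hik => hZO (Fin.castLE h i) k hik
  have hu : IsUnit (topRows h Z).det := by
    rw [isUnit_iff_ne_zero, det_topRows_of_lower h hZ]
    exact Finset.prod_ne_zero_iff.mpr fun k _ => hdiag k
  have hOl : IsLower O := by
    intro i k hik
    have hinv := hD.inv hu
    have : O = (topRows h Z)⁻¹ * (topRows h Z * O) := by
      rw [← Matrix.mul_assoc, Matrix.nonsing_inv_mul _ hu, Matrix.one_mul]
    rw [this, Matrix.mul_apply]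
    refine Finset.sum_eq_zero fun l _ => ?_
    rcases lt_or_ge i.val l.val with h' | h'
    · rw [hinv i l h', zero_mul]
    · rw [hDO l k (by omega), mul_zero]
  have hOu : IsUnit O.det := Matrix.isUnit_det_of_right_inverse hO
  have hOt : IsLower Oᵀ := by
    rw [← Matrix.inv_eq_right_inv hO]
    exact hOl.inv hOu
  have hOd : ∀ i k, i ≠ k → O i k = 0 := by
    intro i k hik
    rcases lt_or_gt_of_ne hik with h' | h'
    · exact hOl i k h'
    · exact hOt k i h'
  have hsq : ∀ k, O k k = 1 ∨ O k k = -1 := by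
    intro k
    rw [← mul_self_eq_one_iff]
    have := congrFun (congrFun hO k) k
    rw [Matrix.mul_apply, Finset.sum_eq_single k, Matrix.one_apply_eq] at this
    · exact this
    · intro l _ hl
      rw [hOd k l hl.symm, zero_mul]
    · simp
  have : ∀ k, ∃ ε : ℤˣ, O k k = (((ε : ℤˣ) : ℤ) : Ω) := by
    intro k
    rcases hsq k with h' | h'
    · exact ⟨1, by simp [h']⟩
    · exact ⟨-1, by simp [h']⟩
  choose ε hε using this
  refine ⟨ε, ?_⟩
  ext i k
  by_cases hik : i = k
  · subst hik
    rw [Matrix.diagonal_apply_eq, hε]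
  · rw [Matrix.diagonal_apply_ne _ hik, hOd i k hik]

theorem signs_mul_transpose (ε : Fin d → ℤˣ) :
    (Matrix.diagonal fun k => (((ε k : ℤˣ) : ℤ) : Ω)) *
      (Matrix.diagonal fun k => (((ε k : ℤˣ) : ℤ) : Ω))ᵀ = 1 := by
  rw [Matrix.diagonal_transpose, Matrix.diagonal_mul_diagonal, ← Matrix.diagonal_one]
  congr 1
  ext k
  rw [← Int.cast_mul, ← Units.val_mul, Int.units_mul_self]
  simp

theorem isLower_diagonal (v : Fin d → Ω) : IsLower (Matrix.diagonal v) := by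
  intro i k hik
  exact Matrix.diagonal_apply_ne _ (by rintro rfl; exact lt_irrefl _ hik)

/-- Each orthogonal orbit of a generic matrix contains exactly `2 ^ d` pinned matrices. -/
theorem card_pinned_orbit [CharZero Ω] (h : d ≤ N) {W Z : Matrix (Fin N) (Fin d) Ω}
    {B L Q R : Matrix (Fin d) (Fin d) Ω}
    (hZ : IsLower Z) (hdiag : ∀ k, Z (Fin.castLE h k) k ≠ 0) (hQ : Q * Qᵀ = 1) (hW : W = Z * Q)
    (hL : IsLower L) (hu : IsUnit L.det) (hR : R * Rᵀ = 1) (hB : B = R * L) :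
    Nat.card {X : Matrix (Fin N) (Fin d) Ω //
      (∃ O : Matrix (Fin d) (Fin d) Ω, O * Oᵀ = 1 ∧ X = W * O) ∧ IsLower (X * B)} = 2 ^ d := by
  have hQ' : Qᵀ * Q = 1 := mul_eq_one_comm.mp hQ
  have hR' : Rᵀ * R = 1 := mul_eq_one_comm.mp hR
  let S : (Fin d → ℤˣ) → Matrix (Fin d) (Fin d) Ω :=
    fun ε => Matrix.diagonal fun k => (((ε k : ℤˣ) : ℤ) : Ω)
  let φ : (Fin d → ℤˣ) → {X : Matrix (Fin N) (Fin d) Ω //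
      (∃ O : Matrix (Fin d) (Fin d) Ω, O * Oᵀ = 1 ∧ X = W * O) ∧ IsLower (X * B)} := fun ε =>
    ⟨Z * S ε * Rᵀ, ⟨Qᵀ * S ε * Rᵀ, by
      have hS : S ε * (S ε)ᵀ = 1 := signs_mul_transpose ε
      rw [Matrix.transpose_mul, Matrix.transpose_mul, Matrix.transpose_transpose,
        Matrix.transpose_transpose]
      calc Qᵀ * S ε * Rᵀ * (R * ((S ε)ᵀ * Q)) = Qᵀ * (S ε * (Rᵀ * R) * (S ε)ᵀ) * Q := by
            simp only [Matrix.mul_assoc]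
        _ = 1 := by rw [hR', Matrix.mul_one, hS, Matrix.mul_one, hQ'], by
      calc Z * S ε * Rᵀ = Z * (Q * Qᵀ) * S ε * Rᵀ := by rw [hQ, Matrix.mul_one]
        _ = W * (Qᵀ * S ε * Rᵀ) := by rw [hW]; simp only [Matrix.mul_assoc]⟩, by
      have : Z * S ε * Rᵀ * B = Z * S ε * L := by
        rw [hB, Matrix.mul_assoc, ← Matrix.mul_assoc Rᵀ, hR', Matrix.one_mul]
      rw [this]
      exact (hZ.mul (isLower_diagonal _)).mul hL⟩
  have hφ : Function.Bijective φ := by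
    constructor
    · intro ε ε' he
      have h1 : Z * S ε * Rᵀ = Z * S ε' * Rᵀ := congrArg Subtype.val he
      have h2 : Z * S ε = Z * S ε' := by
        have := congrArg (· * R) h1
        simpa only [Matrix.mul_assoc, hR', Matrix.mul_one] using this
      ext k
      have h3 := congrFun (congrFun h2 (Fin.castLE h k)) k
      simp only [S, Matrix.mul_diagonal] at h3
      exact_mod_cast mul_left_cancel₀ (hdiag k) h3
    · rintro ⟨X, ⟨O, hO, hX⟩, hlow⟩
      have h1 : X * B = Z * (Q * O * R) * L := by
        rw [hX, hW, hB]; simp only [Matrix.mul_assoc]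
      rw [h1, isLower_mul_iff hL hu] at hlow
      obtain ⟨ε, hε⟩ := exists_signs_of_isLower h hZ hdiag (O := Q * O * R) (by
        rw [Matrix.transpose_mul, Matrix.transpose_mul]
        calc Q * O * R * (Rᵀ * (Oᵀ * Qᵀ)) = Q * (O * (R * Rᵀ) * Oᵀ) * Qᵀ := by
              simp only [Matrix.mul_assoc]
          _ = 1 := by rw [hR, Matrix.mul_one, hO, Matrix.mul_one, hQ]) hlow
      refine ⟨ε, Subtype.ext ?_⟩
      show Z * S ε * Rᵀ = X
      rw [show S ε = Q * O * R from hε.symm, hX, hW]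
      calc Z * (Q * O * R) * Rᵀ = Z * (Q * O * (R * Rᵀ)) := by simp only [Matrix.mul_assoc]
        _ = _ := by rw [hR, Matrix.mul_one, Matrix.mul_assoc]
  rw [← Nat.card_congr (Equiv.ofBijective φ hφ), Nat.card_pi]
  simp

/-- Reversing the columns of the transpose of a generic square matrix gives a product of an
orthogonal and a lower triangular matrix. -/
theorem exists_factor_rev {b L Q : Matrix (Fin d) (Fin d) Ω} (hL : IsLower L) (hu : IsUnit L.det)
    (hQ : Q * Qᵀ = 1) (hb : b = L * Q) :
    ∃ R L' : Matrix (Fin d) (Fin d) Ω, R * Rᵀ = 1 ∧ IsLower L' ∧ IsUnit L'.det ∧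
      bᵀ.submatrix id Fin.rev = R * L' := by
  refine ⟨Qᵀ.submatrix id Fin.revPerm, Lᵀ.submatrix Fin.revPerm Fin.revPerm, ?_, ?_, ?_, ?_⟩
  · rw [Matrix.transpose_submatrix, Matrix.submatrix_mul_equiv, Matrix.transpose_transpose,
      mul_eq_one_comm.mp hQ]
    simp
  · intro i k hik
    refine hL _ _ ?_
    simp only [Fin.revPerm_apply, Fin.val_rev]
    omega
  · rw [Matrix.det_submatrix_equiv_self, Matrix.det_transpose]
    exact hu
  · rw [Matrix.submatrix_mul_equiv, hb, Matrix.transpose_mul]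
    rfl

/-- Difference vectors from the base vertex. -/
def diffMat {R : Type} [CommRing R] (q : Fin (N + 1) → Fin d → R) : Matrix (Fin N) (Fin d) R :=
  Matrix.of fun i k => q i.succ k - q 0 k

theorem congruent_iff {p q : Fin (N + 1) → Fin d → ℂ} :
    Congruent p q ↔ ∃ O : Matrix (Fin d) (Fin d) ℂ, O * Oᵀ = 1 ∧ diffMat p = diffMat q * O := by
  constructor
  · rintro ⟨A, x, hA, hA', h⟩
    refine ⟨Aᵀ, by rwa [Matrix.transpose_transpose], ?_⟩
    ext i k
    simp only [diffMat, Matrix.of_apply, h, Matrix.mul_apply, Matrix.transpose_apply, Pi.add_apply,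
      Matrix.mulVec, dotProduct, add_sub_add_right_eq_sub]
    rw [← Finset.sum_sub_distrib]
    exact Finset.sum_congr rfl fun l _ => by ring
  · rintro ⟨O, hO, h⟩
    refine ⟨Oᵀ, p 0 - Oᵀ.mulVec (q 0), ?_, ?_, fun i => ?_⟩
    · rw [Matrix.transpose_transpose]; exact mul_eq_one_comm.mp hO
    · rwa [Matrix.transpose_transpose]
    · refine Fin.cases ?_ (fun i => ?_) i
      · simp
      · ext k
        have := congrFun (congrFun h i) k
        simp only [diffMat, Matrix.of_apply, Matrix.mul_apply, sub_mul, Finset.sum_sub_distrib] at this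
        simp only [Pi.add_apply, Pi.sub_apply, Matrix.mulVec, dotProduct, Matrix.transpose_apply,
          mul_comm (O _ k)]
        linear_combination this

/-- Inner products of difference vectors from the base vertex. -/
def vertexGram {R : Type} [CommRing R] (q : Fin (N + 1) → Fin d → R) (i j : Fin (N + 1)) : R :=
  ∑ k, (q i k - q 0 k) * (q j k - q 0 k)

theorem sqLen_eq_vertexGram {R : Type} [CommRing R] (q : Fin (N + 1) → Fin d → R)
    (i j : Fin (N + 1)) :
    sqLen q s(i, j) = vertexGram q i i + vertexGram q j j - 2 * vertexGram q i j := by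
  simp only [sqLen_mk, vertexGram, Finset.mul_sum]
  rw [← Finset.sum_add_distrib, ← Finset.sum_sub_distrib]
  exact Finset.sum_congr rfl fun k _ => by ring

theorem vertexGram_cases {R : Type} [CommRing R] (i j : Fin (N + 1)) :
    (∀ q : Fin (N + 1) → Fin d → R, vertexGram q i j = 0) ∨
      ∃ i' j', ∀ q : Fin (N + 1) → Fin d → R, vertexGram q i j = (diffMat q * (diffMat q)ᵀ) i' j' := by
  refine Fin.cases ?_ (fun i => ?_) i
  · left; simp [vertexGram]
  · refine Fin.cases ?_ (fun j => ?_) j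
    · left; simp [vertexGram]
    · exact Or.inr ⟨i, j, fun q => rfl⟩

theorem sqLen_eq_of_gram_eq {R : Type} [CommRing R] {p q : Fin (N + 1) → Fin d → R}
    (h : diffMat p * (diffMat p)ᵀ = diffMat q * (diffMat q)ᵀ) (e : Sym2 (Fin (N + 1))) :
    sqLen p e = sqLen q e := by
  have hg : ∀ i j, vertexGram p i j = vertexGram q i j := fun i j => by
    rcases vertexGram_cases (R := R) (d := d) i j with h' | ⟨i', j', h'⟩
    · rw [h', h']
    · rw [h', h', h]
  induction e with
  | h i j => simp only [sqLen_eq_vertexGram, hg]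

theorem gram_mul_orthogonal {W : Matrix (Fin N) (Fin d) Ω} {O : Matrix (Fin d) (Fin d) Ω}
    (hO : O * Oᵀ = 1) : W * O * (W * O)ᵀ = W * Wᵀ := by
  rw [Matrix.transpose_mul, Matrix.mul_assoc, ← Matrix.mul_assoc O, hO, Matrix.one_mul]

theorem sqLen_eq_of_congruent {p q : Fin (N + 1) → Fin d → ℂ} (h : Congruent p q)
    (e : Sym2 (Fin (N + 1))) : sqLen p e = sqLen q e := by
  obtain ⟨O, hO, h⟩ := congruent_iff.mp h
  exact sqLen_eq_of_gram_eq (by rw [h, gram_mul_orthogonal hO]) e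

theorem sqLen_mem_of_gram_mem {S : Type} [SetLike S Ω] [SubringClass S Ω] {T : S}
    {q : Fin (N + 1) → Fin d → Ω}
    (h : ∀ i j, (diffMat q * (diffMat q)ᵀ) i j ∈ T) (e : Sym2 (Fin (N + 1))) :
    sqLen q e ∈ T := by
  have hg : ∀ i j, vertexGram q i j ∈ T := fun i j => by
    rcases vertexGram_cases (R := Ω) (d := d) i j with h' | ⟨i', j', h'⟩
    · rw [h']; exact zero_mem T
    · rw [h']; exact h _ _
  induction e with
  | h i j =>
    rw [sqLen_eq_vertexGram, two_mul]
    exact sub_mem (add_mem (hg _ _) (hg _ _)) (add_mem (hg _ _) (hg _ _))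

theorem Congruent.refl (p : Fin (N + 1) → Fin d → ℂ) : Congruent p p :=
  congruent_iff.mpr ⟨1, by simp, by simp⟩

theorem Congruent.symm {p q : Fin (N + 1) → Fin d → ℂ} (h : Congruent p q) : Congruent q p := by
  obtain ⟨O, hO, h⟩ := congruent_iff.mp h
  refine congruent_iff.mpr ⟨Oᵀ, by rw [Matrix.transpose_transpose]; exact mul_eq_one_comm.mp hO, ?_⟩
  rw [h, Matrix.mul_assoc, hO, Matrix.mul_one]

theorem Congruent.trans {p q r : Fin (N + 1) → Fin d → ℂ} (h : Congruent p q)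
    (h' : Congruent q r) : Congruent p r := by
  obtain ⟨O, hO, h⟩ := congruent_iff.mp h
  obtain ⟨O', hO', h'⟩ := congruent_iff.mp h'
  refine congruent_iff.mpr ⟨O' * O, ?_, by rw [h, h', Matrix.mul_assoc]⟩
  rw [Matrix.transpose_mul, Matrix.mul_assoc, ← Matrix.mul_assoc O, hO, Matrix.one_mul, hO']

end Pinning

section LowRank

open Matrix

/-- The number of parameters of a symmetric `N × N` matrix of rank `r`. -/
def symRankDim (N r : ℕ) : ℕ := ∑ k ∈ Finset.range r, (N - k)

theorem symRankDim_succ (N r : ℕ) : symRankDim (N + 1) (r + 1) = symRankDim N r + (N + 1) := by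
  simp only [symRankDim, Finset.sum_range_succ']
  congr 1
  exact Finset.sum_congr rfl fun k _ => by omega

variable {Ω : Type} [Field Ω] [Algebra ℚ Ω]

theorem exists_vec_quadratic_ne_zero {ι : Type} [Fintype ι] [DecidableEq ι] {M : Matrix ι ι Ω}
    (hM : M.IsSymm) (h0 : M ≠ 0) :
    ∃ (i : ι) (v : ι → Ω), v i = 1 ∧ (∀ (T : Subfield Ω) u, v u ∈ T) ∧ v ⬝ᵥ M *ᵥ v ≠ 0 := by
  have : CharZero Ω := algebraRat.charZero Ω
  by_cases hd : ∃ i, M i i ≠ 0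
  · obtain ⟨i, hi⟩ := hd
    refine ⟨i, Pi.single i 1, by simp, fun T u => ?_, by simpa using hi⟩
    rw [Pi.single_apply]
    split_ifs
    · exact one_mem T
    · exact zero_mem T
  · push Not at hd
    obtain ⟨i, j, hij⟩ : ∃ i j, M i j ≠ 0 := by
      by_contra! h
      exact h0 (Matrix.ext h)
    have hne : i ≠ j := fun h => hij (h ▸ hd i)
    refine ⟨i, Pi.single i 1 + Pi.single j 1, by simp [hne], fun T u => ?_, ?_⟩
    · rw [Pi.add_apply, Pi.single_apply, Pi.single_apply]
      refine add_mem ?_ ?_ <;>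
      · split_ifs
        · exact one_mem T
        · exact zero_mem T
    · have : M j i = M i j := hM.apply i j
      simp only [Matrix.mulVec_add, dotProduct_add, add_dotProduct, single_one_dotProduct,
        Matrix.mulVec_single_one, Matrix.col_apply, hd, this, zero_add, add_zero]
      rw [← two_mul]
      exact mul_ne_zero two_ne_zero hij

/-- Symmetric matrices of bounded rank depend algebraically on few numbers. -/
theorem exists_finset_of_rank_le (r : ℕ) : ∀ {ι : Type} [Fintype ι] [DecidableEq ι]
    {M : Matrix ι ι Ω}, M.IsSymm → M.rank ≤ r →
    ∃ T : Finset Ω, T.card ≤ symRankDim (Fintype.card ι) r ∧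
      ∀ i j, M i j ∈ relClosure ℚ (T : Set Ω) := by
  induction r with
  | zero =>
    intro ι _ _ M _ hr
    have : M = 0 := by
      rw [Nat.le_zero, Matrix.rank, Submodule.finrank_eq_zero, LinearMap.range_eq_bot] at hr
      exact Matrix.ext fun a b => by simpa using congrFun (LinearMap.congr_fun hr (Pi.single b 1)) a
    exact ⟨∅, by simp, fun i j => by rw [this]; exact zero_mem _⟩
  | succ r ih =>
    intro ι _ _ M hM hr
    by_cases h0 : M = 0
    · exact ⟨∅, by simp, fun i j => by rw [h0]; exact zero_mem _⟩
    obtain ⟨i, v, hvi, hvT, hq⟩ := exists_vec_quadratic_ne_zero hM h0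
    set w := M *ᵥ v with hw
    set c := v ⬝ᵥ w with hc
    set M' : Matrix ι ι Ω := M - c⁻¹ • Matrix.vecMulVec w w with hM'
    have hsym' : M'.IsSymm := by
      refine hM.sub (Matrix.IsSymm.smul ?_ _)
      ext a b
      simp [Matrix.vecMulVec_apply, mul_comm]
    have hmv : ∀ x, M' *ᵥ x = M *ᵥ x - (c⁻¹ * (w ⬝ᵥ x)) • w := by
      intro x
      rw [hM', Matrix.sub_mulVec, Matrix.smul_mulVec, Matrix.vecMulVec_mulVec, mul_smul,
        op_smul_eq_smul]
    have hM'v : M' *ᵥ v = 0 := by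
      rw [hmv, dotProduct_comm w v, ← hc, inv_mul_cancel₀ hq, one_smul, ← hw, sub_self]
    have hwx : ∀ x, M *ᵥ x = 0 → w ⬝ᵥ x = 0 := by
      intro x hx
      rw [hw, ← Matrix.vecMul_transpose, hM.eq, ← Matrix.dotProduct_mulVec, hx, dotProduct_zero]
    have hker : LinearMap.ker M.mulVecLin < LinearMap.ker M'.mulVecLin := by
      refine lt_of_le_of_ne (fun x hx => ?_) fun h => ?_
      · rw [LinearMap.mem_ker, Matrix.mulVecLin_apply] at *
        rw [hmv, hx, hwx x hx, mul_zero, zero_smul, sub_zero]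
      · have : v ∈ LinearMap.ker M.mulVecLin := by
          rw [h, LinearMap.mem_ker, Matrix.mulVecLin_apply, hM'v]
        rw [LinearMap.mem_ker, Matrix.mulVecLin_apply] at this
        exact hq (by rw [hc, hw, this, dotProduct_zero])
    have hrank' : M'.rank ≤ r := by
      have h1 := Submodule.finrank_lt_finrank_of_lt hker
      have h2 := LinearMap.finrank_range_add_finrank_ker M.mulVecLin
      have h3 := LinearMap.finrank_range_add_finrank_ker M'.mulVecLin
      rw [Matrix.rank] at hr ⊢
      omega
    obtain ⟨T', hT'c, hT'⟩ := ih (M := M'.submatrix ((↑) : {u // u ≠ i} → ι) (↑))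
      (hsym'.submatrix _) ((Matrix.rank_submatrix_le _ _ _).trans hrank')
    classical
    refine ⟨T' ∪ Finset.univ.image w, ?_, ?_⟩
    · obtain ⟨K, hK⟩ : ∃ K, Fintype.card ι = K + 1 :=
        Nat.exists_eq_succ_of_ne_zero (Fintype.card_pos_iff.mpr ⟨i⟩).ne'
      have h1 : Fintype.card {u // u ≠ i} = K := by
        rw [Fintype.card_subtype_compl, hK]
        simp
      rw [h1] at hT'c
      rw [hK, symRankDim_succ]
      refine (Finset.card_union_le _ _).trans (add_le_add hT'c ?_)
      refine Finset.card_image_le.trans ?_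
      rw [Finset.card_univ, hK]
    · set T := relClosure ℚ ((T' ∪ Finset.univ.image w : Finset Ω) : Set Ω)
      have hwT : ∀ u, w u ∈ T := fun u => subset_relClosure _ (by simp)
      have hcT : c ∈ T := by
        rw [hc]
        exact sum_mem fun u _ => mul_mem (hvT T.toSubfield u) (hwT u)
      have hle : relClosure ℚ (T' : Set Ω) ≤ T := by
        refine relClosure_le (Set.Subset.trans ?_ (subset_relClosure _))
        simp
      have h1 : ∀ u x, u ≠ i → x ≠ i → M' u x ∈ T := fun u x hu hx => hle (hT' ⟨u, hu⟩ ⟨x, hx⟩)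
      have h2 : ∀ u, (∀ x, x ≠ i → M' u x ∈ T) → M' u i ∈ T := by
        intro u hu
        have := congrFun hM'v u
        rw [Matrix.mulVec, dotProduct, ← Finset.add_sum_erase _ _ (Finset.mem_univ i), hvi, mul_one,
          Pi.zero_apply] at this
        rw [eq_neg_of_add_eq_zero_left this]
        exact neg_mem (sum_mem fun x hx => mul_mem (hu x (Finset.ne_of_mem_erase hx))
          (hvT T.toSubfield x))
      have h3 : ∀ u, u ≠ i → M' u i ∈ T := fun u hu => h2 u fun x hx => h1 u x hu hx
      have h4 : ∀ x, x ≠ i → M' i x ∈ T := fun x hx => by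
        rw [hsym'.apply]
        exact h3 x hx
      have h5 : ∀ u x, M' u x ∈ T := by
        intro u x
        by_cases hu : u = i
        · subst hu
          by_cases hx : x = u
          · subst hx
            exact h2 _ h4
          · exact h4 x hx
        · by_cases hx : x = i
          · subst hx
            exact h3 u hu
          · exact h1 u x hu hx
      intro u x
      have h6 : M u x = M' u x + c⁻¹ * (w u * w x) := by
        simp [hM', Matrix.vecMulVec_apply]
      rw [h6]
      exact add_mem (h5 u x) (mul_mem (inv_mem hcT) (mul_mem (hwT u) (hwT x)))

theorem card_pinIdx {N d : ℕ} (h : d ≤ N) : Nat.card (PinIdx N d) = symRankDim N d := by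
  have e : PinIdx N d ≃ Σ k : Fin d, {i : Fin N // k.val ≤ i.val} :=
    { toFun := fun v => ⟨v.1.2, v.1.1, v.2⟩
      invFun := fun v => ⟨(v.2.1, v.1), v.2.2⟩
      left_inv := fun v => rfl
      right_inv := fun v => rfl }
  rw [Nat.card_congr e, Nat.card_eq_fintype_card, Fintype.card_sigma, symRankDim,
    Finset.sum_range (fun k => N - k)]
  refine Finset.sum_congr rfl fun k _ => ?_
  have hk : k.val < N := k.2.trans_le h
  have := Fin.card_Ici (⟨k.val, hk⟩ : Fin N)
  rw [Fintype.card_subtype]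
  rw [← this]
  congr 1
  ext i
  simp [Fin.le_def]

theorem symRankDim_lt {N d : ℕ} (hd : 1 ≤ d) (h : d ≤ N) :
    symRankDim N (d - 1) < symRankDim N d := by
  obtain ⟨d, rfl⟩ := Nat.exists_eq_succ_of_ne_zero (by omega : d ≠ 0)
  rw [symRankDim, symRankDim, Finset.sum_range_succ, Nat.succ_sub_one]
  omega

end LowRank

section GenericPoint

open Matrix

theorem exists_algebraicIndependent_complex {R ι : Type} [CommRing R] [Nontrivial R]
    [Algebra R ℂ] [FaithfulSMul R ℂ] [Finite ι] (hR : Cardinal.mk R ≤ Cardinal.aleph0) :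
    ∃ u : ι → ℂ, AlgebraicIndependent R u := by
  have : IsDomain R := (FaithfulSMul.algebraMap_injective R ℂ).isDomain (algebraMap R ℂ)
  obtain ⟨s, hs⟩ := exists_isTranscendenceBasis R ℂ
  have h1 := IsAlgClosed.cardinal_eq_cardinal_transcendence_basis_of_aleph0_lt' _ hs hR
    (by rw [Cardinal.mk_complex]; exact Cardinal.aleph0_lt_continuum)
  have h2 : Cardinal.mk ι ≤ Cardinal.mk s := by
    rw [← h1, Cardinal.mk_complex]
    exact (Cardinal.lt_aleph0_of_finite ι).le.trans Cardinal.aleph0_le_continuum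
  obtain ⟨e⟩ := h2
  exact ⟨_, hs.1.comp e e.injective⟩

theorem exists_generic_point {V ι : Type} [Finite V] [Finite ι] {f : MvPolynomial V ℂ}
    (hf : f ≠ 0) : ∃ u : V ⊕ ι → ℂ, AlgebraicIndependent ℚ u ∧
      MvPolynomial.eval (fun v => u (Sum.inl v)) f ≠ 0 := by
  let R : Subalgebra ℚ ℂ := Algebra.adjoin ℚ (f.coeffs : Set ℂ)
  have hR : Cardinal.mk R ≤ Cardinal.aleph0 := by
    refine (Algebra.cardinalMk_adjoin_le ℚ _).trans ?_
    simp
  obtain ⟨u, hu⟩ := exists_algebraicIndependent_complex (ι := V ⊕ ι) hR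
  refine ⟨u, hu.restrictScalars (FaithfulSMul.algebraMap_injective ℚ R), ?_⟩
  obtain ⟨g, hg⟩ : f ∈ Set.range (MvPolynomial.map (algebraMap R ℂ)) := by
    rw [MvPolynomial.mem_range_map_iff_coeffs_subset]
    intro c hc
    exact ⟨⟨c, Algebra.subset_adjoin hc⟩, rfl⟩
  have hg0 : g ≠ 0 := by
    rintro rfl
    exact hf (by rw [← hg, map_zero])
  have hu' := hu.comp (Sum.inl : V → V ⊕ ι) Sum.inl_injective
  rw [← hg, MvPolynomial.eval_map, ← MvPolynomial.aeval_def]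
  exact fun h0 => hg0 (algebraicIndependent_iff.mp hu' g h0)

variable {N d : ℕ}

theorem generic_diffMat (h : d ≤ N) {p : Fin (N + 1) → Fin d → ℂ}
    (hp : AlgebraicIndependent ℚ fun v : Fin (N + 1) × Fin d => p v.1 v.2)
    (π : Equiv.Perm (Fin N)) :
    AlgebraicIndependent ℚ (pinGram h ((diffMat p).submatrix π id)) ∧
      (topRows h ((diffMat p).submatrix π id)).det ≠ 0 := by
  obtain ⟨y, hy⟩ := exists_algebraicIndependent_complex (R := ℚ) (ι := PinIdx N d) (by simp)
  have key := generic_of_surjective h hp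
    (Matrix.of fun i k => MvPolynomial.X ((π i).succ, k) - MvPolynomial.X (0, k)) (fun Z =>
      ⟨fun v => (Fin.cons 0 fun i => Z (π.symm i) v.2 : Fin (N + 1) → ℂ) v.1, by
        ext i k; simp⟩) hy
  have e : (Matrix.of fun i k => (MvPolynomial.X ((π i).succ, k) - MvPolynomial.X (0, k) :
      MvPolynomial (Fin (N + 1) × Fin d) ℚ)).map
      (MvPolynomial.aeval fun v : Fin (N + 1) × Fin d => p v.1 v.2) =
      (diffMat p).submatrix π id := by
    ext i k
    simp [diffMat]
  rwa [e] at key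

theorem generic_diffMat_one (h : d ≤ N) {p : Fin (N + 1) → Fin d → ℂ}
    (hp : AlgebraicIndependent ℚ fun v : Fin (N + 1) × Fin d => p v.1 v.2) :
    AlgebraicIndependent ℚ (pinGram h (diffMat p)) ∧ (topRows h (diffMat p)).det ≠ 0 := by
  simpa using generic_diffMat h hp 1

theorem generic_square {b : Matrix (Fin d) (Fin d) ℂ}
    (hb : AlgebraicIndependent ℚ fun v : Fin d × Fin d => b v.1 v.2) :
    AlgebraicIndependent ℚ (pinGram le_rfl b) ∧ (topRows le_rfl b).det ≠ 0 := by
  obtain ⟨y, hy⟩ := exists_algebraicIndependent_complex (R := ℚ) (ι := PinIdx d d) (by simp)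
  have key := generic_of_surjective le_rfl hb
    (Matrix.of fun i k => MvPolynomial.X (i, k)) (fun Z =>
      ⟨fun v => Z v.1 v.2, by ext i k; simp⟩) hy
  have e : (Matrix.of fun i k => (MvPolynomial.X (i, k) : MvPolynomial (Fin d × Fin d) ℚ)).map
      (MvPolynomial.aeval fun v : Fin d × Fin d => b v.1 v.2) = b := by
    ext i k
    simp
  rwa [e] at key

/-- Generic matrices factor as a pinned matrix times an orthogonal matrix. -/
theorem exists_lower_mul_orthogonal (h : d ≤ N) {W : Matrix (Fin N) (Fin d) ℂ}
    (hM : AlgebraicIndependent ℚ (pinGram h W)) (hW : (topRows h W).det ≠ 0) :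
    ∃ (Z : Matrix (Fin N) (Fin d) ℂ) (Q : Matrix (Fin d) (Fin d) ℂ), IsLower Z ∧
      (∀ k, Z (Fin.castLE h k) k ≠ 0) ∧ Q * Qᵀ = 1 ∧ W = Z * Q := by
  obtain ⟨y, hy⟩ := exists_algebraicIndependent_complex (R := ℚ) (ι := PinIdx N d) (by simp)
  obtain ⟨σ, Q, hQ, e⟩ := exists_aut_orthogonal h (det_topRows_lowerTrap_ne_zero h hy) hW
    (algebraicIndependent_pinGram_lowerTrap h hy) hM
  refine ⟨(lowerTrap y).map σ, Q, fun i k hik => ?_, fun k => ?_, hQ, e⟩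
  · rw [Matrix.map_apply, lowerTrap_lower y i k hik, map_zero]
  · rw [Matrix.map_apply]
    simpa using lowerTrap_diag_ne_zero h hy k

theorem exists_perm_det_topRows_ne_zero {Ω : Type} [Field Ω] (h : d ≤ N)
    {W : Matrix (Fin N) (Fin d) Ω} (hr : W.rank = d) :
    ∃ π : Equiv.Perm (Fin N), (topRows h (W.submatrix π id)).det ≠ 0 := by
  obtain ⟨f, hf, -, hli⟩ := Submodule.exists_fun_fin_finrank_span_eq Ω (Set.range W.row)
  rw [Matrix.rank_eq_finrank_span_row] at hr
  choose r hr' using hf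
  have hinj : Function.Injective r := fun i j hij =>
    hli.injective (by rw [← hr', ← hr', hij])
  obtain ⟨π, hπ⟩ := Equiv.Perm.exists_extending_pair (Fin.castLE h)
    (fun k => r (Fin.cast hr.symm k)) (Fin.castLE_injective h)
    (hinj.comp (Fin.cast_injective _))
  refine ⟨π, ?_⟩
  rw [← isUnit_iff_ne_zero, ← Matrix.isUnit_iff_isUnit_det, ← Matrix.linearIndependent_rows_iff_isUnit]
  have e : (topRows h (W.submatrix π id)).row = f ∘ Fin.cast hr.symm := by
    ext k l
    have := congrFun (hr' (Fin.cast hr.symm k)) l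
    simpa [topRows, hπ] using this
  rw [e]
  exact hli.comp _ (Fin.cast_injective _)

end GenericPoint

section Fibre

open Matrix

variable {N d : ℕ} {G : SimpleGraph (Fin (N + 1))}

theorem card_edgeSet_le (h : d ≤ N) {p : Fin (N + 1) → Fin d → ℂ}
    (hp : AlgebraicIndependent ℚ fun v : Fin (N + 1) × Fin d => p v.1 v.2)
    (ha : AlgebraicIndependent ℚ fun e : G.edgeSet => sqLen p (e : Sym2 (Fin (N + 1)))) :
    Nat.card G.edgeSet ≤ Nat.card (PinIdx N d) := by
  have h1 := card_le_of_mem_relClosure ha (s := Set.range (pinGram h (diffMat p))) fun e =>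
    sqLen_mem_of_gram_mem (gram_mem_relClosure_pinGram h (generic_diffMat_one h hp).2) e
  have h2 : (Set.range (pinGram h (diffMat p))).encard ≤ Nat.card (PinIdx N d) := by
    rw [← Set.image_univ, ← ENat.card_eq_coe_natCard, ← Set.encard_univ]
    exact Set.encard_image_le _ _
  exact_mod_cast h1.trans h2

theorem gram_eq_of_congruent {p q : Fin (N + 1) → Fin d → ℂ} (h : Congruent p q) :
    diffMat p * (diffMat p)ᵀ = diffMat q * (diffMat q)ᵀ := by
  obtain ⟨O, hO, h⟩ := congruent_iff.mp h
  rw [h, gram_mul_orthogonal hO]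

theorem congClass_eq_iff {S : Set (Fin (N + 1) → Fin d → ℂ)} {q q' : Fin (N + 1) → Fin d → ℂ}
    (hq' : q' ∈ S) :
    {r ∈ S | Congruent q r} = {r ∈ S | Congruent q' r} ↔ Congruent q q' := by
  constructor
  · intro e
    have : q' ∈ {r ∈ S | Congruent q r} := by
      rw [e]
      exact ⟨hq', Congruent.refl _⟩
    exact this.2
  · intro hc
    ext r
    exact and_congr_right fun _ => ⟨fun hr => hc.symm.trans hr, fun hr => hc.trans hr⟩

theorem pinGram_mem_relClosure_sqLen (h : d ≤ N) {p : Fin (N + 1) → Fin d → ℂ}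
    (ha : AlgebraicIndependent ℚ fun e : G.edgeSet => sqLen p (e : Sym2 (Fin (N + 1))))
    (hfin : 0 < (congClasses {q | rigidityMap G d q = rigidityMap G d p}).ncard) (v : PinIdx N d) :
    pinGram h (diffMat p) v ∈
      relClosure ℚ (Set.range fun e : G.edgeSet => sqLen p (e : Sym2 (Fin (N + 1)))) := by
  by_contra hv
  set a := fun e : G.edgeSet => sqLen p (e : Sym2 (Fin (N + 1)))
  set t := pinGram h (diffMat p) v
  have hind : ∀ j : ℕ, AlgebraicIndependent ℚ fun o : Option G.edgeSet => o.elim (t + j) a := by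
    intro j
    rw [AlgebraicIndependent.option_iff_transcendental ha]
    intro halg
    rw [← mem_relClosure_iff] at halg
    refine hv ?_
    have := sub_mem halg (natCast_mem (relClosure ℚ (Set.range a)) j)
    rwa [add_sub_cancel_right] at this
  have hσ : ∀ j : ℕ, ∃ σ : ℂ ≃+* ℂ, σ t = t + j ∧ ∀ e, σ (a e) = a e := by
    intro j
    obtain ⟨σ, hσ⟩ := exists_ringEquiv_of_algebraicIndependent
      (by rw [Cardinal.mk_complex]; exact Cardinal.aleph0_lt_continuum) rfl (hind 0) (hind j)
    exact ⟨σ, by simpa using hσ none, fun e => hσ (some e)⟩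
  choose σ hσt hσa using hσ
  let q : ℕ → Fin (N + 1) → Fin d → ℂ := fun j i k => σ j (p i k)
  have hq : ∀ j, q j ∈ {q | rigidityMap G d q = rigidityMap G d p} := by
    intro j
    rw [Set.mem_ofPred_eq, rigidityMap_eq_iff]
    intro e
    rw [← map_sqLen]
    exact hσa j e
  have hqt : ∀ j, pinGram h (diffMat (q j)) v = t + j := by
    intro j
    rw [← hσt j, map_pinGram]
    congr 1
    ext i k
    simp [q, diffMat]
  refine hfin.ne' (Set.Infinite.ncard ?_)
  refine Set.infinite_of_injective_forall_mem (f := fun j =>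
    {r ∈ {q | rigidityMap G d q = rigidityMap G d p} | Congruent (q j) r}) ?_ fun j => ⟨q j, hq j, rfl⟩
  intro i j hij
  have h1 := gram_eq_of_congruent ((congClass_eq_iff (hq j)).mp hij)
  have h2 : pinGram h (diffMat (q i)) v = pinGram h (diffMat (q j)) v := by
    rw [pinGram, pinGram, h1]
  rw [hqt, hqt] at h2
  exact_mod_cast add_left_cancel h2

theorem card_edgeSet_eq (h : d ≤ N) {p : Fin (N + 1) → Fin d → ℂ}
    (hp : AlgebraicIndependent ℚ fun v : Fin (N + 1) × Fin d => p v.1 v.2)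
    (ha : AlgebraicIndependent ℚ fun e : G.edgeSet => sqLen p (e : Sym2 (Fin (N + 1))))
    (hfin : 0 < (congClasses {q | rigidityMap G d q = rigidityMap G d p}).ncard) :
    Nat.card G.edgeSet = Nat.card (PinIdx N d) := by
  refine le_antisymm (card_edgeSet_le h hp ha) ?_
  have h1 := card_le_of_mem_relClosure (generic_diffMat_one h hp).1
    (pinGram_mem_relClosure_sqLen h ha hfin)
  have h2 : (Set.range fun e : G.edgeSet => sqLen p (e : Sym2 (Fin (N + 1)))).encard ≤
      Nat.card G.edgeSet := by
    rw [← Set.image_univ, ← ENat.card_eq_coe_natCard, ← Set.encard_univ]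
    exact Set.encard_image_le _ _
  exact_mod_cast h1.trans h2

theorem rank_diffMat_eq (hd : 1 ≤ d) (h : d ≤ N) {q : Fin (N + 1) → Fin d → ℂ}
    (ha : AlgebraicIndependent ℚ fun e : G.edgeSet => sqLen q (e : Sym2 (Fin (N + 1))))
    (hcard : Nat.card G.edgeSet = Nat.card (PinIdx N d)) : (diffMat q).rank = d := by
  refine le_antisymm (by simpa using (diffMat q).rank_le_width) ?_
  by_contra hlt
  obtain ⟨T, hTc, hT⟩ := exists_finset_of_rank_le (d - 1)
    (M := diffMat q * (diffMat q)ᵀ) (by rw [Matrix.IsSymm, Matrix.transpose_mul, Matrix.transpose_transpose])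
    ((Matrix.rank_mul_le_left _ _).trans (by omega))
  have h1 := card_le_of_mem_relClosure ha fun e => sqLen_mem_of_gram_mem hT e
  rw [Set.encard_coe_eq_coe_finsetCard, hcard, card_pinIdx h] at h1
  have h2 := symRankDim_lt hd h
  rw [Fintype.card_fin] at hTc
  have h3 : symRankDim N d ≤ T.card := by exact_mod_cast h1
  omega

theorem exists_pinned_of_mem_fibre (hd : 1 ≤ d) (h : d ≤ N) {p q : Fin (N + 1) → Fin d → ℂ}
    (hp : AlgebraicIndependent ℚ fun v : Fin (N + 1) × Fin d => p v.1 v.2)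
    (ha : AlgebraicIndependent ℚ fun e : G.edgeSet => sqLen q (e : Sym2 (Fin (N + 1))))
    (hcard : Nat.card G.edgeSet = Nat.card (PinIdx N d)) :
    ∃ (Z : Matrix (Fin N) (Fin d) ℂ) (Q : Matrix (Fin d) (Fin d) ℂ), IsLower Z ∧
      (∀ k, Z (Fin.castLE h k) k ≠ 0) ∧ Q * Qᵀ = 1 ∧ diffMat q = Z * Q := by
  obtain ⟨π, hπ⟩ := exists_perm_det_topRows_ne_zero h (rank_diffMat_eq hd h ha hcard)
  have hgram : ∀ i j, (diffMat q * (diffMat q)ᵀ) i j ∈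
      relClosure ℚ (Set.range (pinGram h ((diffMat q).submatrix π id))) := by
    intro i j
    have := gram_mem_relClosure_pinGram h hπ (π.symm i) (π.symm j)
    have e : ((diffMat q).submatrix π id * ((diffMat q).submatrix π id)ᵀ) (π.symm i) (π.symm j) =
        (diffMat q * (diffMat q)ᵀ) i j := by
      simp [Matrix.mul_apply]
    rwa [e] at this
  have hMπ := algebraicIndependent_of_mem_relClosure ha
    (fun e => sqLen_mem_of_gram_mem hgram e) hcard.ge
  obtain ⟨hp1, hp2⟩ := generic_diffMat h hp π
  obtain ⟨σ, O, hO, e⟩ := exists_aut_orthogonal h hp2 hπ hp1 hMπ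
  have e' : diffMat q = (diffMat p).map σ * O := by
    ext i k
    have := congrFun (congrFun e (π.symm i)) k
    simpa [Matrix.mul_apply] using this
  have hdet : (topRows h (diffMat q)).det ≠ 0 := by
    have e2 : topRows h (diffMat q) = σ.toRingHom.mapMatrix (topRows h (diffMat p)) * O := by
      rw [e']
      rfl
    rw [e2, Matrix.det_mul, ← RingHom.map_det]
    refine mul_ne_zero ?_ (Matrix.isUnit_det_of_right_inverse hO).ne_zero
    simpa using (generic_diffMat_one h hp).2
  have hM := algebraicIndependent_of_mem_relClosure ha
    (fun e => sqLen_mem_of_gram_mem (gram_mem_relClosure_pinGram h hdet) e) hcard.ge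
  exact exists_lower_mul_orthogonal h hM hdet

end Fibre

section Count

open Matrix

variable {N d : ℕ}

/-- The pinning equations with coefficient matrix `b`. -/
def IsPinned {R : Type} [CommRing R] (b : Matrix (Fin d) (Fin d) R) (x : Fin (N + 1) → Fin d → R) :
    Prop :=
  ∀ (i : Fin (N + 1)) (l : Fin d), i.val < d → l.val < d - i.val → ∑ k, b l k * (x i k - 1) = 0

theorem isPinned_iff {K : Type} [CommRing K] (hd : 1 ≤ d) {b : Matrix (Fin d) (Fin d) K}
    (hb : IsUnit b.det) (x : Fin (N + 1) → Fin d → K) :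
    IsPinned b x ↔ x 0 = 1 ∧ IsLower (diffMat x * bᵀ.submatrix id Fin.rev) := by
  have key : ∀ (j : Fin N) (k : Fin d), x 0 = 1 →
      (diffMat x * bᵀ.submatrix id Fin.rev) j k = ∑ l, b k.rev l * (x j.succ l - 1) := by
    intro j k h0
    rw [Matrix.mul_apply]
    refine Finset.sum_congr rfl fun l _ => ?_
    simp only [diffMat, Matrix.of_apply, Matrix.submatrix_apply, Matrix.transpose_apply, id, h0,
      Pi.one_apply]
    ring
  constructor
  · intro h
    have h0 : x 0 = 1 := by
      have hz : b.mulVec (x 0 - 1) = 0 := by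
        ext l
        simpa [Matrix.mulVec, dotProduct] using h 0 l (by simp; omega) (by simp)
      refine sub_eq_zero.mp (Matrix.mulVec_injective_of_isUnit
        ((Matrix.isUnit_iff_isUnit_det b).mpr hb) ?_)
      rw [hz, Matrix.mulVec_zero]
    refine ⟨h0, fun j k hjk => ?_⟩
    rw [key j k h0]
    have := k.isLt
    exact h j.succ k.rev (by rw [Fin.val_succ]; omega)
      (by rw [Fin.val_succ, Fin.val_rev]; omega)
  · rintro ⟨h0, hl⟩ i l hi hli
    refine Fin.cases (fun _ _ => ?_) (fun j hj hlj => ?_) i hi hli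
    · simp [h0]
    · have := hl j l.rev (by rw [Fin.val_rev]; rw [Fin.val_succ] at hlj; omega)
      rwa [key j _ h0, Fin.rev_rev] at this

theorem card_eq_mul_of_fibre {α β : Type} [Finite β] {m : ℕ} (hm : 0 < m) (f : α → β)
    (h : ∀ y, Nat.card {x // f x = y} = m) : Nat.card α = m * Nat.card β := by
  have := Fintype.ofFinite β
  have hf : ∀ y, Finite {x // f x = y} := fun y =>
    Nat.finite_of_card_ne_zero (by rw [h y]; exact hm.ne')
  rw [← Nat.card_congr (Equiv.sigmaFiberEquiv f), Nat.card_sigma]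
  simp [h, mul_comm]

/-- A realisation is determined by its difference matrix and the position of its first vertex. -/
def pinnedEquiv (N d : ℕ) : {x : Fin (N + 1) → Fin d → ℂ // x 0 = 1} ≃ Matrix (Fin N) (Fin d) ℂ where
  toFun x := diffMat x.1
  invFun X := ⟨Fin.cons 1 fun i k => X i k + 1, rfl⟩
  left_inv := by
    rintro ⟨x, hx⟩
    ext i k
    refine Fin.cases ?_ (fun j => ?_) i
    · simp [hx]
    · simp [diffMat, hx]
  right_inv X := by
    ext i k
    simp [diffMat]

variable {G : SimpleGraph (Fin (N + 1))}

/-- The pinned realisations with the same edge lengths as `p`. -/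
abbrev PinnedFibre (G : SimpleGraph (Fin (N + 1))) (b : Matrix (Fin d) (Fin d) ℂ)
    (p : Fin (N + 1) → Fin d → ℂ) : Type :=
  {x : Fin (N + 1) → Fin d → ℂ //
    (∀ e : G.edgeSet, sqLen x (e : Sym2 (Fin (N + 1))) = sqLen p e) ∧ IsPinned b x}

theorem card_pinnedFibre (hd : 1 ≤ d) (h : d ≤ N) {p : Fin (N + 1) → Fin d → ℂ}
    {b : Matrix (Fin d) (Fin d) ℂ}
    (hp : AlgebraicIndependent ℚ fun v : Fin (N + 1) × Fin d => p v.1 v.2)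
    (hb : AlgebraicIndependent ℚ fun v : Fin d × Fin d => b v.1 v.2)
    (ha : AlgebraicIndependent ℚ fun e : G.edgeSet => sqLen p (e : Sym2 (Fin (N + 1))))
    (hfin : 0 < (congClasses {q | rigidityMap G d q = rigidityMap G d p}).ncard) :
    Nat.card (PinnedFibre G b p) =
      2 ^ d * (congClasses {q | rigidityMap G d q = rigidityMap G d p}).ncard := by
  set S := {q | rigidityMap G d q = rigidityMap G d p} with hS
  have hmem : ∀ q, q ∈ S ↔ ∀ e : G.edgeSet, sqLen q (e : Sym2 (Fin (N + 1))) = sqLen p e :=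
    fun q => rigidityMap_eq_iff
  have hcard := card_edgeSet_eq h hp ha hfin
  obtain ⟨hbg, hbdet⟩ := generic_square hb
  obtain ⟨L, Q, hL, hdiag, hQ, hbLQ⟩ := exists_lower_mul_orthogonal le_rfl hbg hbdet
  have hu : IsUnit L.det := by
    have e : L.det = ∏ k, L (Fin.castLE le_rfl k) k := det_topRows_of_lower le_rfl hL
    rw [e]
    exact (Finset.prod_ne_zero_iff.mpr fun k _ => hdiag k).isUnit
  have hbd : IsUnit b.det := IsUnit.mk0 _ hbdet
  obtain ⟨R, L', hR, hL', hu', hB⟩ := exists_factor_rev hL hu hQ hbLQ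
  have : Finite (congClasses S) := Set.finite_of_ncard_pos hfin
  rw [← Nat.card_coe_set_eq]
  refine card_eq_mul_of_fibre (by positivity) (fun x : PinnedFibre G b p =>
    (⟨{r ∈ S | Congruent x.1 r}, x.1, (hmem _).mpr x.2.1, rfl⟩ : congClasses S)) ?_
  rintro ⟨_, q, hq, rfl⟩
  have hq' := (hmem q).mp hq
  obtain ⟨Z, Q', hZ, hZd, hQ', hqZ⟩ := exists_pinned_of_mem_fibre (G := G) (q := q) hd h hp
    (by simpa only [hq'] using ha) hcard
  rw [← card_pinned_orbit h hZ hZd hQ' hqZ hL' hu' hR hB]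
  have hiff : ∀ x : Fin (N + 1) → Fin d → ℂ,
      (((∀ e : G.edgeSet, sqLen x (e : Sym2 (Fin (N + 1))) = sqLen p e) ∧ IsPinned b x) ∧
        {r ∈ S | Congruent x r} = {r ∈ S | Congruent q r}) ↔
      x 0 = 1 ∧ (∃ O : Matrix (Fin d) (Fin d) ℂ, O * Oᵀ = 1 ∧ diffMat x = diffMat q * O) ∧
        IsLower (diffMat x * bᵀ.submatrix id Fin.rev) := by
    intro x
    rw [congClass_eq_iff hq, isPinned_iff hd hbd, ← congruent_iff]
    constructor
    · rintro ⟨⟨-, h0, hl⟩, hc⟩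
      exact ⟨h0, hc, hl⟩
    · rintro ⟨h0, hc, hl⟩
      exact ⟨⟨fun e => (sqLen_eq_of_congruent hc e).trans (hq' e), h0, hl⟩, hc⟩
  refine Nat.card_congr ?_
  refine Equiv.trans (Equiv.subtypeEquivRight
    (q := fun x : PinnedFibre G b p => {r ∈ S | Congruent x.1 r} = {r ∈ S | Congruent q r})
    fun x => Subtype.ext_iff) ?_
  refine (Equiv.subtypeSubtypeEquivSubtypeInter _ 
    (fun x : Fin (N + 1) → Fin d → ℂ => {r ∈ S | Congruent x r} = {r ∈ S | Congruent q r})).trans ?_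
  refine (Equiv.subtypeEquivRight hiff).trans ?_
  refine (Equiv.subtypeSubtypeEquivSubtypeInter (fun x : Fin (N + 1) → Fin d → ℂ => x 0 = 1) _).symm.trans ?_
  exact (pinnedEquiv N d).subtypeEquiv fun x => Iff.rfl

end Count

section LaurentAlgebra

theorem finrank_eq_card_algHom {K A Ω : Type} [Field K] [CharZero K] [CommRing A] [Algebra K A]
    [Field Ω] [Algebra K Ω] [IsAlgClosed Ω] [Algebra.IsAlgebraic K Ω] [Algebra.FiniteType K A]
    (h : A →ₐ[K] Ω) (hinj : Function.Injective h) :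
    Module.finrank K A = Nat.card (A →ₐ[K] Ω) := by
  have halg : Algebra.IsAlgebraic K A := Algebra.IsAlgebraic.of_injective h hinj
  have hint : Algebra.IsIntegral K A := Algebra.isAlgebraic_iff_isIntegral.mp halg
  have hfin : Module.Finite K A := Algebra.IsIntegral.finite
  have : IsDomain A := hinj.isDomain h.toRingHom
  let _ : Field A := (isField_of_isIntegral_of_isField' (Field.toIsField K)).toField
  exact (AlgHom.natCard_of_splits K A Ω fun x => IsAlgClosed.splits _).symm

/-- Elements of `A` which are quotients of elements of `θ(S)`. -/
def fractionSubring {S A : Type} [CommRing S] [CommRing A] (θ : S →+* A) : Subring A where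
  carrier := {z | ∃ s t : S, IsUnit (θ s) ∧ θ s * z = θ t}
  mul_mem' := by
    rintro x y ⟨s, t, hs, e⟩ ⟨s', t', hs', e'⟩
    refine ⟨s * s', t * t', by rw [map_mul]; exact hs.mul hs', ?_⟩
    rw [map_mul, map_mul, ← e, ← e']
    ring
  one_mem' := ⟨1, 1, by simp, by simp⟩
  add_mem' := by
    rintro x y ⟨s, t, hs, e⟩ ⟨s', t', hs', e'⟩
    refine ⟨s * s', s' * t + s * t', by rw [map_mul]; exact hs.mul hs', ?_⟩
    rw [map_mul, map_add, map_mul, map_mul, ← e, ← e']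
    ring
  zero_mem' := ⟨1, 0, by simp, by simp⟩
  neg_mem' := by
    rintro x ⟨s, t, hs, e⟩
    exact ⟨s, -t, hs, by rw [map_neg, ← e, mul_neg]⟩

theorem range_mem_fractionSubring {S A : Type} [CommRing S] [CommRing A] (θ : S →+* A) (s : S) :
    θ s ∈ fractionSubring θ :=
  ⟨1, s, by simp, by simp⟩

theorem inv_mem_fractionSubring {S A : Type} [CommRing S] [CommRing A] (θ : S →+* A) {x y : A}
    (hx : x ∈ fractionSubring θ) (hxy : x * y = 1) : y ∈ fractionSubring θ := by
  obtain ⟨s, t, hs, e⟩ := hx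
  refine ⟨t, s, ?_, ?_⟩
  · rw [← e]
    exact hs.mul (IsUnit.of_mul_eq_one y hxy)
  · rw [← e, mul_assoc, hxy, mul_one]

theorem injective_of_fractionSubring_eq_top {S A Ω : Type} [CommRing S] [CommRing A] [Field Ω]
    (θ : S →+* A) (h : A →+* Ω) (hθ : Function.Injective (h.comp θ)) (hT : fractionSubring θ = ⊤) :
    Function.Injective h := by
  rw [injective_iff_map_eq_zero]
  intro z hz
  have hzT : z ∈ fractionSubring θ := hT ▸ Subring.mem_top z
  obtain ⟨s, t, hs, e⟩ := hzT
  have ht : (h.comp θ) t = (h.comp θ) 0 := by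
    rw [map_zero, RingHom.comp_apply, ← e, map_mul, hz, mul_zero]
  rw [hθ ht, map_zero] at e
  exact (hs.mul_right_eq_zero).mp e

variable {K V Ω : Type} [Field K] [Field Ω] [Algebra K Ω]

theorem LX_mul_LXinv (v : V) : (LX v : LaurentRing K V) * LXinv v = 1 := by
  rw [LX, LXinv, AddMonoidAlgebra.single_mul_single, ← Finsupp.single_add, add_neg_cancel,
    Finsupp.single_zero, one_mul]
  rfl

/-- A subalgebra containing the variables and their inverses is everything. -/
theorem laurent_mem_of_LX_mem {T : Subalgebra K (LaurentRing K V)} (h : ∀ v, LX v ∈ T)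
    (h' : ∀ v, LXinv v ∈ T) (z : LaurentRing K V) : z ∈ T := by
  have hof : ∀ m : V →₀ ℤ, AddMonoidAlgebra.of K (V →₀ ℤ) (Multiplicative.ofAdd m) ∈ T := by
    intro m
    induction m using Finsupp.induction_linear with
    | zero => rw [ofAdd_zero, map_one]; exact one_mem T
    | add f g hf hg => rw [ofAdd_add, map_mul]; exact mul_mem hf hg
    | single v n =>
      have hsplit : ∀ n : ℕ, Finsupp.single v (n : ℤ) = n • Finsupp.single v 1 := fun n => by simp
      have hsplit' : ∀ n : ℕ, Finsupp.single v (-(n : ℤ)) = n • Finsupp.single v (-1) :=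
        fun n => by simp
      obtain ⟨n, rfl | rfl⟩ := n.eq_nat_or_neg
      · rw [hsplit, ofAdd_nsmul, map_pow]
        exact pow_mem (h v) n
      · rw [hsplit', ofAdd_nsmul, map_pow]
        exact pow_mem (h' v) n
  induction z using AddMonoidAlgebra.induction_on with
  | of m => exact hof m
  | add x y hx hy => exact add_mem hx hy
  | smul r x hx => exact T.smul_mem hx r

/-- Algebra homomorphisms out of a Laurent polynomial ring are determined by the variables. -/
theorem laurent_hom_ext {B : Type} [CommRing B] [Algebra K B] {φ ψ : LaurentRing K V →ₐ[K] B}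
    (h : ∀ v, φ (LX v) = ψ (LX v)) : φ = ψ := by
  refine AlgHom.ext fun z => ?_
  refine laurent_mem_of_LX_mem (T := AlgHom.equalizer φ ψ) h (fun v => ?_) z
  have h1 : φ (LX v) * φ (LXinv v) = 1 := by rw [← map_mul, LX_mul_LXinv, map_one]
  have h2 : φ (LX v) * ψ (LXinv v) = 1 := by rw [h, ← map_mul, LX_mul_LXinv, map_one]
  show φ (LXinv v) = ψ (LXinv v)
  calc φ (LXinv v) = φ (LXinv v) * (φ (LX v) * ψ (LXinv v)) := by rw [h2, mul_one]
    _ = (φ (LX v) * φ (LXinv v)) * ψ (LXinv v) := by ring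
    _ = _ := by rw [h1, one_mul]

theorem exists_laurent_hom (x : V → Ω) (hx : ∀ v, x v ≠ 0) :
    ∃ φ : LaurentRing K V →ₐ[K] Ω, ∀ v, φ (LX v) = x v := by
  let u : (V →₀ ℤ) →+ Additive Ωˣ :=
    Finsupp.liftAddHom fun v => zmultiplesHom (Additive Ωˣ) (Additive.ofMul (Units.mk0 (x v) (hx v)))
  refine ⟨AddMonoidAlgebra.lift K Ω (V →₀ ℤ)
    ((Units.coeHom Ω).comp (AddMonoidHom.toMultiplicativeLeft u)), fun v => ?_⟩
  rw [LX, AddMonoidAlgebra.lift_single, one_smul]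
  simp [u]

/-- Homomorphisms out of a quotient of the Laurent polynomial ring to a field correspond to
nonvanishing solutions of the equations. -/
theorem card_laurent_quotient_hom (s : Set (LaurentRing K V)) (P : (V → Ω) → Prop)
    (hP : ∀ x, P x → ∀ v, x v ≠ 0)
    (hs : ∀ φ : LaurentRing K V →ₐ[K] Ω, (∀ g ∈ s, φ g = 0) ↔ P fun v => φ (LX v)) :
    Nat.card ((LaurentRing K V ⧸ Ideal.span s) →ₐ[K] Ω) = Nat.card {x // P x} := by
  have hker : ∀ (ψ : (LaurentRing K V ⧸ Ideal.span s) →ₐ[K] Ω), ∀ g ∈ s,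
      ψ.comp (Ideal.Quotient.mkₐ K (Ideal.span s)) g = 0 := fun ψ g hg => by
    rw [AlgHom.comp_apply, Ideal.Quotient.mkₐ_eq_mk,
      Ideal.Quotient.eq_zero_iff_mem.mpr (Ideal.subset_span hg), map_zero]
  refine Nat.card_congr (Equiv.ofBijective
    (fun ψ => ⟨_, (hs (ψ.comp (Ideal.Quotient.mkₐ K (Ideal.span s)))).mp (hker ψ)⟩) ⟨?_, ?_⟩)
  · intro ψ ψ' e
    refine Ideal.Quotient.algHom_ext K (laurent_hom_ext fun v => ?_)
    exact congrFun (Subtype.ext_iff.mp e) v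
  · rintro ⟨x, hx⟩
    obtain ⟨φ, hφ⟩ := exists_laurent_hom (K := K) x (hP x hx)
    have hx' : (fun v => φ (LX v)) = x := funext hφ
    have hle : ∀ a ∈ Ideal.span s, φ a = 0 := by
      intro a ha
      have : Ideal.span s ≤ RingHom.ker φ.toRingHom :=
        Ideal.span_le.mpr ((hs φ).mpr (hx' ▸ hx))
      exact this ha
    refine ⟨Ideal.Quotient.liftₐ _ φ hle, Subtype.ext ?_⟩
    exact hx'

end LaurentAlgebra

section PinCoordinates

open Matrix

variable {N d : ℕ} {R : Type} [CommRing R]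

/-- The triangular coordinates of a pinned realisation. -/
def pinCoord (b : Matrix (Fin d) (Fin d) R) (x : Fin (N + 1) → Fin d → R) (v : PinIdx N d) : R :=
  (diffMat x * bᵀ.submatrix id Fin.rev) v.1.1 v.1.2

theorem map_pinCoord {S : Type} [CommRing S] (φ : R →+* S) (b : Matrix (Fin d) (Fin d) R)
    (x : Fin (N + 1) → Fin d → R) (v : PinIdx N d) :
    φ (pinCoord b x v) = pinCoord (φ.mapMatrix b) (fun i k => φ (x i k)) v := by
  simp [pinCoord, Matrix.mul_apply, diffMat]

theorem isUnit_det_rev {b : Matrix (Fin d) (Fin d) R} (hb : IsUnit b.det) :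
    IsUnit (bᵀ.submatrix id Fin.rev).det := by
  have e : (bᵀ.submatrix id Fin.rev).det = (bᵀ.submatrix id Fin.revPerm).det := rfl
  rw [e, Matrix.det_permute', Matrix.det_transpose]
  exact ((Units.isUnit _).map (Int.castRingHom R)).mul hb

theorem det_smul_diffMat (b : Matrix (Fin d) (Fin d) R) (x : Fin (N + 1) → Fin d → R) :
    (bᵀ.submatrix id Fin.rev).det • diffMat x =
      diffMat x * bᵀ.submatrix id Fin.rev * (bᵀ.submatrix id Fin.rev).adjugate := by
  rw [Matrix.mul_assoc, Matrix.mul_adjugate, Matrix.mul_smul, Matrix.mul_one]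

theorem coord_mem_of_pinCoord_mem (hd : 1 ≤ d) {T : Subring R}
    (hT : ∀ x y, x ∈ T → x * y = 1 → y ∈ T) {b : Matrix (Fin d) (Fin d) R} (hb : IsUnit b.det)
    (hbT : ∀ i j, b i j ∈ T) {x : Fin (N + 1) → Fin d → R} (hx : IsPinned b x)
    (hxT : ∀ v, pinCoord b x v ∈ T) (i : Fin (N + 1)) (k : Fin d) : x i k ∈ T := by
  obtain ⟨h0, hl⟩ := (isPinned_iff hd hb x).mp hx
  refine Fin.cases (by rw [h0]; exact one_mem T) (fun j => ?_) i
  have hY : ∀ j k, (diffMat x * bᵀ.submatrix id Fin.rev) j k ∈ T := by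
    intro j k
    by_cases hjk : k.val ≤ j.val
    · exact hxT ⟨(j, k), hjk⟩
    · rw [hl j k (by omega)]
      exact zero_mem T
  have hB : ∀ i j, bᵀ.submatrix id Fin.rev i j ∈ T := fun i j => hbT _ _
  obtain ⟨y, hy⟩ := (isUnit_det_rev hb).exists_right_inv
  have hyT := hT _ y (det_mem_of_forall_mem hB) hy
  have hD : (bᵀ.submatrix id Fin.rev).det * diffMat x j k ∈ T := by
    have := congrFun (congrFun (det_smul_diffMat b x) j) k
    rw [Matrix.smul_apply, smul_eq_mul] at this
    rw [this, Matrix.mul_apply]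
    exact sum_mem fun l _ => mul_mem (hY j l) (adjugate_mem_of_forall_mem hB l k)
  have hD' : diffMat x j k ∈ T := by
    have e : diffMat x j k = y * ((bᵀ.submatrix id Fin.rev).det * diffMat x j k) := by
      rw [← mul_assoc, mul_comm y, hy, one_mul]
    rw [e]
    exact mul_mem hyT hD
  have e : x j.succ k = diffMat x j k + 1 := by simp [diffMat, h0]
  rw [e]
  exact add_mem hD' (one_mem T)

theorem sqLen_mem_of_coord_mem {T : Subring R} {x : Fin (N + 1) → Fin d → R}
    (hx : ∀ i k, x i k ∈ T) (e : Sym2 (Fin (N + 1))) : sqLen x e ∈ T := by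
  induction e with
  | h i j =>
    rw [sqLen_mk]
    exact sum_mem fun k _ => pow_mem (sub_mem (hx i k) (hx j k)) 2

variable {Ω : Type} [Field Ω] [Algebra ℂ Ω] {G : SimpleGraph (Fin (N + 1))}

/-- The pinning coefficients and the triangular coordinates of a generic pinned realisation are
algebraically independent. -/
theorem algebraicIndependent_pinCoord (hd : 1 ≤ d)
    (hcard : Nat.card G.edgeSet = Nat.card (PinIdx N d))
    {π : G.edgeSet ⊕ Fin d × Fin d → Ω} (hπ : AlgebraicIndependent ℂ π)
    {b : Matrix (Fin d) (Fin d) Ω} (hb : ∀ l k, b l k = π (Sum.inr (l, k))) (hdet : b.det ≠ 0)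
    {x : Fin (N + 1) → Fin d → Ω}
    (hx : ∀ e : G.edgeSet, sqLen x (e : Sym2 (Fin (N + 1))) = π (Sum.inl e)) (hp : IsPinned b x) :
    AlgebraicIndependent ℂ (Sum.elim (fun v : Fin d × Fin d => b v.1 v.2) (pinCoord b x)) := by
  set u : Fin d × Fin d ⊕ PinIdx N d → Ω :=
    Sum.elim (fun v : Fin d × Fin d => b v.1 v.2) (pinCoord b x)
  have hbu : ∀ l k, b l k ∈ relClosure ℂ (Set.range u) := fun l k =>
    mem_relClosure_range u (Sum.inl (l, k))
  have hxu : ∀ i k, x i k ∈ (relClosure ℂ (Set.range u)).toSubfield.toSubring :=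
    coord_mem_of_pinCoord_mem hd (fun a c ha hac => by
      rw [eq_inv_of_mul_eq_one_right hac]
      exact (relClosure ℂ (Set.range u)).inv_mem ha) hdet.isUnit hbu hp fun v => mem_relClosure_range u (Sum.inr v)
  refine algebraicIndependent_of_mem_relClosure hπ ?_ ?_
  · rintro (e | ⟨l, k⟩)
    · rw [← hx]
      exact sqLen_mem_of_coord_mem hxu _
    · rw [← hb]
      exact hbu l k
  · rw [Nat.card_sum, Nat.card_sum, hcard, add_comm]

/-- The coordinates of a generic pinned realisation do not vanish. -/
theorem coord_ne_zero_of_algebraicIndependent (hd : 1 ≤ d) {b : Matrix (Fin d) (Fin d) Ω}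
    (hdet : b.det ≠ 0) {x : Fin (N + 1) → Fin d → Ω} (hp : IsPinned b x)
    (hu : AlgebraicIndependent ℂ
      (Sum.elim (fun v : Fin d × Fin d => b v.1 v.2) (pinCoord b x)))
    (i : Fin (N + 1)) (k : Fin d) : x i k ≠ 0 := by
  obtain ⟨h0, hl⟩ := (isPinned_iff hd hdet.isUnit x).mp hp
  refine Fin.cases (by simp [h0]) (fun j => ?_) i
  set S := MvPolynomial (Fin d × Fin d ⊕ PinIdx N d) ℂ
  let B : Matrix (Fin d) (Fin d) S := Matrix.of fun l k => MvPolynomial.X (Sum.inl (k.rev, l))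
  let Y : Matrix (Fin N) (Fin d) S := Matrix.of fun i k =>
    if hik : k.val ≤ i.val then MvPolynomial.X (Sum.inr ⟨(i, k), hik⟩) else 0
  let f : S := B.det + (Y * B.adjugate) j k
  have hf : ∀ {F : Type} [Field F] [Algebra ℂ F] (w : Fin d × Fin d ⊕ PinIdx N d → F)
      (B' : Matrix (Fin d) (Fin d) F) (Y' : Matrix (Fin N) (Fin d) F),
      (∀ l k, B' l k = w (Sum.inl (k.rev, l))) → (∀ v : PinIdx N d, Y' v.1.1 v.1.2 = w (Sum.inr v)) →
      IsLower Y' → MvPolynomial.aeval w f = B'.det + (Y' * B'.adjugate) j k := by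
    intro F _ _ w B' Y' hB hY hYl
    have hB' : B.map (MvPolynomial.aeval w) = B' := by
      ext l k
      simp [B, hB]
    have hY' : Y.map (MvPolynomial.aeval w) = Y' := by
      ext i k
      by_cases hik : k.val ≤ i.val
      · simp [Y, hik, ← hY]
      · simp [Y, hik, hYl i k (by omega)]
    rw [map_add, ← hB', AlgHom.map_det]
    congr 1
    rw [← hY']
    have := (MvPolynomial.aeval w).map_adjugate B
    simp only [AlgHom.mapMatrix_apply] at this
    rw [← this, ← Matrix.map_mul, Matrix.map_apply]
  have hf0 : f ≠ 0 := by
    intro h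
    have := hf (F := ℂ) (Sum.elim (fun v => if v.1.rev = v.2 then 1 else 0) 0) 1 0
      (fun l k => by simp [Matrix.one_apply, eq_comm]) (fun v => by simp) (fun _ _ _ => rfl)
    rw [h] at this
    simp at this
  have hfu := hf (Sum.elim (fun v : Fin d × Fin d => b v.1 v.2) (pinCoord b x))
    (bᵀ.submatrix id Fin.rev) (diffMat x * bᵀ.submatrix id Fin.rev) (fun l k => by simp)
    (fun v => rfl) hl
  rw [← det_smul_diffMat, Matrix.smul_apply, smul_eq_mul] at hfu
  intro hxz
  have e : diffMat x j k = -1 := by simp [diffMat, h0, hxz]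
  rw [e, mul_neg_one, add_neg_cancel] at hfu
  exact hf0 (hu (by rw [hfu, map_zero]))

end PinCoordinates

section GenericParameters

open Matrix

variable {N d : ℕ} {G : SimpleGraph (Fin (N + 1))}

/-- The matrix of pinning parameters. -/
def pinParam (E : Type) (d : ℕ) : Matrix (Fin d) (Fin d) (RatFuncField (E ⊕ Fin d × Fin d)) :=
  Matrix.of fun l k => ratParam (Sum.inr (l, k))

theorem det_pinParam_ne_zero (E : Type) (d : ℕ) : (pinParam E d).det ≠ 0 := by
  let B : Matrix (Fin d) (Fin d) (MvPolynomial (E ⊕ Fin d × Fin d) ℂ) :=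
    Matrix.of fun l k => MvPolynomial.X (Sum.inr (l, k))
  have e : pinParam E d = (algebraMap _ (RatFuncField (E ⊕ Fin d × Fin d))).mapMatrix B := rfl
  rw [e, ← RingHom.map_det]
  intro h
  rw [FaithfulSMul.algebraMap_eq_zero_iff] at h
  let ev := MvPolynomial.eval₂Hom (RingHom.id ℂ)
    (Sum.elim (0 : E → ℂ) fun v : Fin d × Fin d => (1 : Matrix (Fin d) (Fin d) ℂ) v.1 v.2)
  have h1 : ev.mapMatrix B = 1 := by
    ext l k
    simp [B, ev]
  have h2 := ev.map_det B
  rw [h, h1, map_zero, Matrix.det_one] at h2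
  exact zero_ne_one h2

/-- An algebraic closure of the field of parameters. -/
abbrev ParamClosure (P : Type) : Type := AlgebraicClosure (RatFuncField P)

/-- The parameters as elements of the algebraic closure. -/
def closureParam {P : Type} (p : P) : ParamClosure P := algebraMap (RatFuncField P) _ (ratParam p)

theorem algebraicIndependent_closureParam (P : Type) :
    AlgebraicIndependent ℂ (closureParam (P := P)) := by
  have h : AlgebraicIndependent ℂ (MvPolynomial.X : P → MvPolynomial P ℂ) :=
    MvPolynomial.algebraicIndependent_X P ℂ
  have h1 := h.map' (f := IsScalarTower.toAlgHom ℂ (MvPolynomial P ℂ) (RatFuncField P))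
    (IsFractionRing.injective _ _)
  exact h1.map' (f := IsScalarTower.toAlgHom ℂ (RatFuncField P) (ParamClosure P))
    (algebraMap (RatFuncField P) (ParamClosure P)).injective

theorem mk_paramClosure (P : Type) [Finite P] : Cardinal.mk (ParamClosure P) = Cardinal.mk ℂ := by
  refine le_antisymm ?_ (Cardinal.mk_le_of_injective (algebraMap ℂ (ParamClosure P)).injective)
  have h1 : Cardinal.aleph0 ≤ Cardinal.mk ℂ := by
    rw [Cardinal.mk_complex]
    exact Cardinal.aleph0_le_continuum
  have h2 : Cardinal.mk (RatFuncField P) ≤ Cardinal.mk ℂ := by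
    rw [Cardinal.mk_fractionRing]
    refine MvPolynomial.cardinalMk_le_max.trans (max_le (max_le le_rfl ?_) h1)
    exact (Cardinal.lt_aleph0_of_finite P).le.trans h1
  exact (Algebra.IsAlgebraic.cardinalMk_le_max (RatFuncField P) (ParamClosure P)).trans
    (max_le h2 h1)

/-- The pinned realisations with generic edge lengths. -/
def IsGenericSolution (G : SimpleGraph (Fin (N + 1))) (d : ℕ)
    (x : Fin (N + 1) → Fin d → ParamClosure (G.edgeSet ⊕ Fin d × Fin d)) : Prop :=
  (∀ e : G.edgeSet, sqLen x (e : Sym2 (Fin (N + 1))) = closureParam (Sum.inl e)) ∧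
    IsPinned ((algebraMap _ (ParamClosure (G.edgeSet ⊕ Fin d × Fin d))).mapMatrix
      (pinParam G.edgeSet d)) x

theorem IsPinned.map {R S : Type} [CommRing R] [CommRing S] (φ : R →+* S)
    {b : Matrix (Fin d) (Fin d) R} {x : Fin (N + 1) → Fin d → R} (h : IsPinned b x) :
    IsPinned (φ.mapMatrix b) fun i k => φ (x i k) := by
  intro i l hi hl
  have := congrArg φ (h i l hi hl)
  simpa [map_sum] using this

theorem card_genericSolution (τ : ParamClosure (G.edgeSet ⊕ Fin d × Fin d) ≃+* ℂ)
    {b : Matrix (Fin d) (Fin d) ℂ} {p : Fin (N + 1) → Fin d → ℂ}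
    (hτ : ∀ v, τ (closureParam v) = Sum.elim
      (fun e : G.edgeSet => sqLen p (e : Sym2 (Fin (N + 1)))) (fun v => b v.1 v.2) v) :
    Nat.card {x // IsGenericSolution G d x} = Nat.card (PinnedFibre G b p) := by
  refine Nat.card_congr (Equiv.subtypeEquiv
    (Equiv.arrowCongr (Equiv.refl _) (Equiv.arrowCongr (Equiv.refl _) τ.toEquiv)) fun x => ?_)
  have hb : τ.toRingHom.mapMatrix ((algebraMap _ (ParamClosure (G.edgeSet ⊕ Fin d × Fin d))).mapMatrix
      (pinParam G.edgeSet d)) = b := by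
    ext l k
    exact hτ (Sum.inr (l, k))
  refine and_congr (forall_congr' fun e => ?_) ⟨fun h => ?_, fun h => ?_⟩
  · rw [← τ.injective.eq_iff, map_sqLen, hτ]
    rfl
  · rw [← hb]
    exact h.map τ.toRingHom
  · have h' := h.map τ.symm.toRingHom
    rw [← hb] at h'
    intro i l hi hl
    have := h' i l hi hl
    simpa using this

theorem algebraicIndependent_sum_of_forall_mem {V ι κ : Type} {u : V ⊕ ι → ℂ}
    (hu : AlgebraicIndependent ℚ u) {a : κ → ℂ} (ha : AlgebraicIndependent ℚ a)
    (h : ∀ j, a j ∈ Algebra.adjoin ℚ (Set.range fun v => u (Sum.inl v))) :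
    AlgebraicIndependent ℚ (Sum.elim a fun i => u (Sum.inr i)) := by
  have hu' : AlgebraicIndependent ℚ (Sum.elim (fun i => u (Sum.inr i)) fun v => u (Sum.inl v)) := by
    have := hu.comp (Sum.swap) (Equiv.sumComm ι V).injective
    convert this using 1
    ext (i | v) <;> rfl
  rw [AlgebraicIndependent.sumElim_iff] at hu'
  have hle : Algebra.adjoin ℚ (Set.range a) ≤
      Algebra.adjoin ℚ (Set.range fun v => u (Sum.inl v)) := by
    rw [Algebra.adjoin_le_iff]
    rintro _ ⟨j, rfl⟩
    exact h j
  algebraize [(Subalgebra.inclusion hle).toRingHom]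
  have : IsScalarTower (Algebra.adjoin ℚ (Set.range a))
      (Algebra.adjoin ℚ (Set.range fun v => u (Sum.inl v))) ℂ := IsScalarTower.of_algebraMap_eq fun _ => rfl
  have hr := hu'.2.restrictScalars (R := Algebra.adjoin ℚ (Set.range a))
    (Subalgebra.inclusion_injective hle)
  have hs := (ha.sumElim hr).comp Sum.swap (Equiv.sumComm κ ι).injective
  convert hs using 1
  ext (i | v) <;> rfl

end GenericParameters

section GenericSolutions

open Matrix

variable {N d c : ℕ} {G : SimpleGraph (Fin (N + 1))}

theorem card_genericSolution_eq (hd : 1 ≤ d) (h : d ≤ N) (hG : IsMinimallyRigidGraph G d)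
    (hc : IsRealisationNumber G d c) :
    Nat.card {x // IsGenericSolution G d x} = 2 ^ d * c ∧
      Nat.card G.edgeSet = Nat.card (PinIdx N d) := by
  obtain ⟨hc0, f, hf, hfc⟩ := hc
  obtain ⟨u, hu, hfu⟩ := exists_generic_point (ι := Fin d × Fin d) hf
  let p : Fin (N + 1) → Fin d → ℂ := fun i k => u (Sum.inl (i, k))
  let b : Matrix (Fin d) (Fin d) ℂ := Matrix.of fun l k => u (Sum.inr (l, k))
  have hp : AlgebraicIndependent ℚ fun v : Fin (N + 1) × Fin d => p v.1 v.2 :=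
    hu.comp Sum.inl Sum.inl_injective
  have hb : AlgebraicIndependent ℚ fun v : Fin d × Fin d => b v.1 v.2 :=
    hu.comp Sum.inr Sum.inr_injective
  have ha := algebraicIndependent_sqLen hG hp
  have hfp := hfc p hfu
  have hfin : 0 < (congClasses {q | rigidityMap G d q = rigidityMap G d p}).ncard := by
    rwa [hfp]
  have hab := algebraicIndependent_sum_of_forall_mem hu ha fun e =>
    sqLen_mem_of_coord_mem (T := (Algebra.adjoin ℚ (Set.range fun v => u (Sum.inl v))).toSubring)
      (x := p) (fun i k => Algebra.subset_adjoin (Set.mem_range_self (i, k))) _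
  have hK := mk_paramClosure (G.edgeSet ⊕ Fin d × Fin d)
  obtain ⟨τ, hτ⟩ := exists_ringEquiv_of_algebraicIndependent
    (by rw [hK, Cardinal.mk_complex]; exact Cardinal.aleph0_lt_continuum) hK
    ((algebraicIndependent_closureParam (G.edgeSet ⊕ Fin d × Fin d)).restrictScalars
      (algebraMap ℚ ℂ).injective) hab
  refine ⟨?_, card_edgeSet_eq h hp ha hfin⟩
  rw [card_genericSolution (b := b) (p := p) τ hτ, card_pinnedFibre hd h hp hb ha hfin, hfp]

theorem genericSolution_ne_zero (hd : 1 ≤ d) (hcard : Nat.card G.edgeSet = Nat.card (PinIdx N d))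
    {x : Fin (N + 1) → Fin d → ParamClosure (G.edgeSet ⊕ Fin d × Fin d)}
    (hx : IsGenericSolution G d x) :
    AlgebraicIndependent ℂ (Sum.elim (fun v : Fin d × Fin d => closureParam (Sum.inr v))
      (pinCoord ((algebraMap _ (ParamClosure (G.edgeSet ⊕ Fin d × Fin d))).mapMatrix
        (pinParam G.edgeSet d)) x)) ∧ ∀ i k, x i k ≠ 0 := by
  have hdet : ((algebraMap _ (ParamClosure (G.edgeSet ⊕ Fin d × Fin d))).mapMatrix
      (pinParam G.edgeSet d)).det ≠ 0 := by
    rw [← RingHom.map_det]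
    exact (map_ne_zero _).mpr (det_pinParam_ne_zero _ _)
  have hu := algebraicIndependent_pinCoord hd hcard
    (algebraicIndependent_closureParam (G.edgeSet ⊕ Fin d × Fin d)) (fun l k => rfl) hdet hx.1 hx.2
  exact ⟨hu, coord_ne_zero_of_algebraicIndependent hd hdet hx.2 hu⟩

theorem ratField_mem {P A : Type} [CommRing A] [Algebra (RatFuncField P) A] {T : Subring A}
    (hT : ∀ x y, x ∈ T → x * y = 1 → y ∈ T)
    (hC : ∀ z : ℂ, algebraMap (RatFuncField P) A (algebraMap ℂ _ z) ∈ T)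
    (hX : ∀ v, algebraMap (RatFuncField P) A (ratParam v) ∈ T) (r : RatFuncField P) :
    algebraMap (RatFuncField P) A r ∈ T := by
  have hpol : ∀ f : MvPolynomial P ℂ, algebraMap (RatFuncField P) A (algebraMap _ _ f) ∈ T := by
    intro f
    induction f using MvPolynomial.induction_on with
    | C z => exact hC z
    | add f g hf hg => rw [map_add, map_add]; exact add_mem hf hg
    | mul_X f v hf => rw [map_mul, map_mul]; exact mul_mem hf (hX v)
  obtain ⟨f, g, hg, rfl⟩ := IsFractionRing.div_surjective (A := MvPolynomial P ℂ) r
  have hg0 : algebraMap (MvPolynomial P ℂ) (RatFuncField P) g ≠ 0 :=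
    IsFractionRing.to_map_ne_zero_of_mem_nonZeroDivisors hg
  rw [div_eq_mul_inv, map_mul]
  refine mul_mem (hpol f) (hT _ _ (hpol g) ?_)
  rw [← map_mul, mul_inv_cancel₀ hg0, map_one]

/-- Every point over the algebraic closure of an algebra generated by a pinned realisation with
generic edge lengths is injective. -/
theorem injective_of_generated {A : Type} [CommRing A]
    [Algebra (RatFuncField (G.edgeSet ⊕ Fin d × Fin d)) A] (hd : 1 ≤ d)
    (hcard : Nat.card G.edgeSet = Nat.card (PinIdx N d)) (x xinv : Fin (N + 1) → Fin d → A)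
    (hinv : ∀ i k, x i k * xinv i k = 1)
    (hgen : ∀ T : Subalgebra (RatFuncField (G.edgeSet ⊕ Fin d × Fin d)) A,
      (∀ i k, x i k ∈ T) → (∀ i k, xinv i k ∈ T) → ∀ z, z ∈ T)
    (hedge : ∀ e : G.edgeSet, sqLen x (e : Sym2 (Fin (N + 1))) =
      algebraMap (RatFuncField (G.edgeSet ⊕ Fin d × Fin d)) A (ratParam (Sum.inl e)))
    (hpin : IsPinned ((algebraMap _ A).mapMatrix (pinParam G.edgeSet d)) x)
    (h : A →ₐ[RatFuncField (G.edgeSet ⊕ Fin d × Fin d)]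
      ParamClosure (G.edgeSet ⊕ Fin d × Fin d)) : Function.Injective h := by
  let K := RatFuncField (G.edgeSet ⊕ Fin d × Fin d)
  set b : Matrix (Fin d) (Fin d) A := (algebraMap K A).mapMatrix (pinParam G.edgeSet d) with hb
  have hdet : IsUnit b.det := by
    rw [hb, ← RingHom.map_det]
    exact (det_pinParam_ne_zero _ _).isUnit.map _
  let θ : MvPolynomial (Fin d × Fin d ⊕ PinIdx N d) ℂ →+* A :=
    MvPolynomial.eval₂Hom ((algebraMap K A).comp (algebraMap ℂ K))
      (Sum.elim (fun v => b v.1 v.2) (pinCoord b x))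
  have hbT : ∀ l k, b l k ∈ fractionSubring θ := fun l k => by
    have := range_mem_fractionSubring θ (MvPolynomial.X (Sum.inl (l, k)))
    simpa [θ] using this
  have hxT : ∀ i k, x i k ∈ fractionSubring θ :=
    coord_mem_of_pinCoord_mem hd (fun _ _ => inv_mem_fractionSubring θ) hdet hbT hpin fun v => by
      have := range_mem_fractionSubring θ (MvPolynomial.X (Sum.inr v))
      simpa [θ] using this
  have hKT : ∀ r : K, algebraMap K A r ∈ fractionSubring θ := by
    refine ratField_mem (fun _ _ => inv_mem_fractionSubring θ) (fun z => ?_) ?_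
    · have := range_mem_fractionSubring θ (MvPolynomial.C z)
      simpa [θ] using this
    · rintro (e | ⟨l, k⟩)
      · rw [← hedge]
        exact sqLen_mem_of_coord_mem hxT _
      · exact hbT l k
  have hT : fractionSubring θ = ⊤ := by
    refine (Subring.eq_top_iff' _).mpr fun z => ?_
    exact hgen { fractionSubring θ with algebraMap_mem' := hKT } hxT
      (fun i k => inv_mem_fractionSubring θ (hxT i k) (hinv i k)) z
  have hbh : h.toRingHom.mapMatrix b = (algebraMap _ (ParamClosure (G.edgeSet ⊕ Fin d × Fin d))).mapMatrix
      (pinParam G.edgeSet d) := by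
    ext l k
    exact h.commutes _
  have hsol : IsGenericSolution G d fun i k => h (x i k) := by
    refine ⟨fun e => ?_, ?_⟩
    · rw [← map_sqLen, hedge, AlgHom.commutes]
      rfl
    · rw [← hbh]
      exact hpin.map h.toRingHom
  have hu := (genericSolution_ne_zero hd hcard hsol).1
  refine injective_of_fractionSubring_eq_top θ h.toRingHom ?_ hT
  have hcomp : h.toRingHom.comp θ = (MvPolynomial.aeval
      (Sum.elim (fun v : Fin d × Fin d => closureParam (Sum.inr v))
        (pinCoord ((algebraMap _ (ParamClosure (G.edgeSet ⊕ Fin d × Fin d))).mapMatrix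
          (pinParam G.edgeSet d)) fun i k => h (x i k)))).toRingHom := by
    refine MvPolynomial.ringHom_ext (fun z => ?_) ?_
    · simp only [θ, RingHom.comp_apply, MvPolynomial.coe_eval₂Hom, MvPolynomial.eval₂_C,
        AlgHom.toRingHom_eq_coe, RingHom.coe_coe, MvPolynomial.aeval_C]
      exact (h.commutes _).trans (IsScalarTower.algebraMap_apply ℂ K _ z).symm
    · rintro (v | v)
      · simp only [θ, RingHom.comp_apply, MvPolynomial.coe_eval₂Hom, MvPolynomial.eval₂_X,
          AlgHom.toRingHom_eq_coe, RingHom.coe_coe, MvPolynomial.aeval_X, Sum.elim_inl]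
        exact h.commutes _
      · simp only [θ, RingHom.comp_apply, MvPolynomial.coe_eval₂Hom, MvPolynomial.eval₂_X,
          AlgHom.toRingHom_eq_coe, RingHom.coe_coe, MvPolynomial.aeval_X, Sum.elim_inr]
        rw [← hbh]
        exact map_pinCoord h.toRingHom b x v
  rw [hcomp]
  exact hu

end GenericSolutions

section RootCount

variable {N d : ℕ} {G : SimpleGraph (Fin (N + 1))}

theorem finrank_eq_card_genericSolution (hd : 1 ≤ d)
    (hcard : Nat.card G.edgeSet = Nat.card (PinIdx N d))
    (hpos : 0 < Nat.card {x // IsGenericSolution G d x})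
    (s : Set (LaurentRing (RatFuncField (G.edgeSet ⊕ Fin d × Fin d)) (Fin (N + 1) × Fin d)))
    (hs : ∀ (B : Type) [CommRing B] [Algebra (RatFuncField (G.edgeSet ⊕ Fin d × Fin d)) B]
      (φ : LaurentRing (RatFuncField (G.edgeSet ⊕ Fin d × Fin d)) (Fin (N + 1) × Fin d)
        →ₐ[RatFuncField (G.edgeSet ⊕ Fin d × Fin d)] B),
      (∀ g ∈ s, φ g = 0) ↔
        (∀ e : G.edgeSet, sqLen (fun i k => φ (LX (i, k))) (e : Sym2 (Fin (N + 1))) =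
          algebraMap (RatFuncField (G.edgeSet ⊕ Fin d × Fin d)) B (ratParam (Sum.inl e))) ∧
        IsPinned ((algebraMap _ B).mapMatrix (pinParam G.edgeSet d)) fun i k => φ (LX (i, k))) :
    Module.finrank (RatFuncField (G.edgeSet ⊕ Fin d × Fin d))
      (LaurentRing (RatFuncField (G.edgeSet ⊕ Fin d × Fin d)) (Fin (N + 1) × Fin d) ⧸
        Ideal.span s) = Nat.card {x // IsGenericSolution G d x} := by
  let K := RatFuncField (G.edgeSet ⊕ Fin d × Fin d)
  have hcount : Nat.card ((LaurentRing K (Fin (N + 1) × Fin d) ⧸ Ideal.span s) →ₐ[K]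
      ParamClosure (G.edgeSet ⊕ Fin d × Fin d)) = Nat.card {x // IsGenericSolution G d x} := by
    rw [card_laurent_quotient_hom s (fun x => IsGenericSolution G d fun i k => x (i, k))
      (fun x hx v => (genericSolution_ne_zero hd hcard hx).2 v.1 v.2) fun φ => hs _ φ]
    exact Nat.card_congr ((Equiv.curry _ _ _).subtypeEquiv fun x => Iff.rfl)
  rw [← hcount] at hpos ⊢
  obtain ⟨h⟩ := (Nat.card_pos_iff.mp hpos).1
  have hfg : AddMonoid.FG ((Fin (N + 1) × Fin d) →₀ ℤ) :=
    AddGroup.fg_iff_addMonoid_fg.mp (Module.Finite.iff_addGroup_fg.mp inferInstance)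
  have hft : Algebra.FiniteType K (LaurentRing K (Fin (N + 1) × Fin d)) :=
    AddMonoidAlgebra.finiteType_of_fg _ _
  let mk := Ideal.Quotient.mkₐ K (Ideal.span s)
  have hmk : Function.Surjective mk := Ideal.Quotient.mkₐ_surjective K _
  have hft' : Algebra.FiniteType K (LaurentRing K (Fin (N + 1) × Fin d) ⧸ Ideal.span s) :=
    hft.of_surjective mk hmk
  refine finrank_eq_card_algHom h ?_
  obtain ⟨hedge, hpin⟩ := (hs _ mk).mp fun g hg =>
    Ideal.Quotient.eq_zero_iff_mem.mpr (Ideal.subset_span hg)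
  refine injective_of_generated hd hcard (fun i k => mk (LX (i, k))) (fun i k => mk (LXinv (i, k)))
    (fun i k => by rw [← map_mul, LX_mul_LXinv, map_one]) (fun T hT hT' z => ?_) hedge hpin h
  obtain ⟨z, rfl⟩ := hmk z
  exact laurent_mem_of_LX_mem (T := T.comap mk) (fun v => hT v.1 v.2) (fun v => hT' v.1 v.2) z

end RootCount

/-- For a minimally `d`-rigid graph `G` with `n ≥ d + 1`, the generic
root count of the vertex-variable system `I_V` (edge-length polynomials and
vertex-pinning polynomials) equals `2^d · c_d(G)`. -/
theorem statement_11 {n d : ℕ} (hd : 1 ≤ d) (hn : d + 1 ≤ n)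
    (G : SimpleGraph (Fin n)) (hG : IsMinimallyRigidGraph G d)
    (c : ℕ) (hc : IsRealisationNumber G d c) :
    Module.finrank (RatFuncField (↥G.edgeSet ⊕ Fin d × Fin d))
      (LaurentRing (RatFuncField (↥G.edgeSet ⊕ Fin d × Fin d)) (Fin n × Fin d) ⧸
        Ideal.span (
          {g : LaurentRing (RatFuncField (↥G.edgeSet ⊕ Fin d × Fin d)) (Fin n × Fin d) |
            ∃ (i j : Fin n) (h : G.Adj i j),
              g = (∑ k : Fin d, (LX (i, k) - LX (j, k)) ^ 2) -
                algebraMap _ _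
                  (ratParam (P := ↥G.edgeSet ⊕ Fin d × Fin d) (Sum.inl (⟨s(i, j), G.mem_edgeSet.mpr h⟩ : ↥G.edgeSet)))} ∪
          {g : LaurentRing (RatFuncField (↥G.edgeSet ⊕ Fin d × Fin d)) (Fin n × Fin d) |
            ∃ (i : Fin n) (l : Fin d), i.val < d ∧ l.val < d - i.val ∧
              g = ∑ k : Fin d,
                algebraMap _ _ (ratParam (P := ↥G.edgeSet ⊕ Fin d × Fin d) (Sum.inr (l, k))) * (LX (i, k) - 1)})) =
      2 ^ d * c := by
  obtain ⟨N, rfl⟩ : ∃ N, n = N + 1 := ⟨n - 1, by omega⟩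
  have h : d ≤ N := by omega
  obtain ⟨hcount, hcard⟩ := card_genericSolution_eq hd h hG hc
  rw [← hcount]
  refine finrank_eq_card_genericSolution hd hcard ?_ _ ?_
  · rw [hcount]
    exact Nat.mul_pos (by positivity) hc.1
  · intro B _ _ φ
    have hedge : ∀ i j (hij : G.Adj i j), φ ((∑ k : Fin d, (LX (i, k) - LX (j, k)) ^ 2) -
        algebraMap _ _ (ratParam (P := ↥G.edgeSet ⊕ Fin d × Fin d)
          (Sum.inl (⟨s(i, j), G.mem_edgeSet.mpr hij⟩ : ↥G.edgeSet)))) = 0 ↔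
        sqLen (fun i k => φ (LX (i, k))) s(i, j) =
          algebraMap _ B (ratParam (P := ↥G.edgeSet ⊕ Fin d × Fin d) (Sum.inl (⟨s(i, j), G.mem_edgeSet.mpr hij⟩ : ↥G.edgeSet))) := fun i j hij => by
      rw [map_sub, sub_eq_zero, AlgHom.commutes, sqLen_mk, map_sum]
      simp only [map_pow, map_sub]
    have hpin : ∀ (i : Fin (N + 1)) (l : Fin d), φ (∑ k : Fin d, algebraMap _ _
        (ratParam (P := ↥G.edgeSet ⊕ Fin d × Fin d) (Sum.inr (l, k))) * (LX (i, k) - 1)) =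
        ∑ k, (algebraMap _ B).mapMatrix (pinParam G.edgeSet d) l k * (φ (LX (i, k)) - 1) :=
      fun i l => by
        simp only [map_sum, map_mul, map_sub, map_one, AlgHom.commutes]
        rfl
    constructor
    · intro hφ
      refine ⟨?_, fun i l hi hl => ?_⟩
      · rintro ⟨e, he⟩
        induction e with
        | h i j => exact (hedge i j he).mp (hφ _ (Or.inl ⟨i, j, he, rfl⟩))
      · rw [← hpin]
        exact hφ _ (Or.inr ⟨i, l, hi, hl, rfl⟩)
    · rintro ⟨he, hp⟩ g (⟨i, j, hij, rfl⟩ | ⟨i, l, hi, hl, rfl⟩)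
      · exact (hedge i j hij).mpr (he ⟨s(i, j), G.mem_edgeSet.mpr hij⟩)
      · rw [hpin]
        exact hp i l hi hl

end PaperDefs
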